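/- (Consequence of Schneider's theorem) Let V be an n-dimensional Euclidean vector space and let μ be a continuous, translation invariant, complex-valued valuation on V which is odd (μ(-K) = -μ(K)) and simple, i.e. μ(K) = 0 for every nonempty compact convex K contained in some affine hyperplane of V. Then μ is homogeneous of degree n - 1, i.e. μ(tK) = t^{n-1} μ(K) for every t ≥ 0 and every nonempty compact convex K ⊆ V. -/

import Mathlib

open MeasureTheory Metric Set
open scoped Pointwise ENNReal

noncomputable section

variable {V : Type*} [NormedAddCommGroup V] [NormedSpace ℝ V]

/-- `μ` is a (complex-valued) valuation: additivity on unions of convex bodies whose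
union is again convex. -/
def IsValuationC (μ : ConvexBody V → ℂ) : Prop :=
  ∀ K L M N : ConvexBody V,
    (M : Set V) = (K : Set V) ∪ (L : Set V) → (N : Set V) = (K : Set V) ∩ (L : Set V) →
      μ M + μ N = μ K + μ L

/-- `μ` is translation invariant. -/
def IsTranslationInvariantC (μ : ConvexBody V → ℂ) : Prop :=
  ∀ (x : V) (K L : ConvexBody V), (L : Set V) = x +ᵥ (K : Set V) → μ L = μ K

/-- `μ` is homogeneous of degree `k`. -/
def IsHomogeneousValC (k : ℕ) (μ : ConvexBody V → ℂ) : Prop :=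
  ∀ (t : ℝ), 0 ≤ t → ∀ K L : ConvexBody V,
    (L : Set V) = t • (K : Set V) → μ L = (t : ℂ) ^ k * μ K

/-- `μ` is an even valuation. -/
def IsEvenValC (μ : ConvexBody V → ℂ) : Prop :=
  ∀ K L : ConvexBody V, (L : Set V) = -(K : Set V) → μ L = μ K

/-- `μ` is an odd valuation. -/
def IsOddValC (μ : ConvexBody V → ℂ) : Prop :=
  ∀ K L : ConvexBody V, (L : Set V) = -(K : Set V) → μ L = -μ K

/-- `μ` is simple: it vanishes on convex bodies contained in some affine hyperplane
(a translate of a linear subspace of dimension `n - 1`, `n = dim V`). -/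
def IsSimpleValC (n : ℕ) (μ : ConvexBody V → ℂ) : Prop :=
  ∀ K : ConvexBody V,
    (∃ (E : Submodule ℝ V) (x : V),
      Module.finrank ℝ E = n - 1 ∧ (K : Set V) ⊆ x +ᵥ (E : Set V)) → μ K = 0

set_option linter.unusedSectionVars false

section Basics

variable {E : Type*} [NormedAddCommGroup E] [InnerProductSpace ℝ E]

/-- convex bodies as sets -/
def IsBody (K : Set E) : Prop := Convex ℝ K ∧ IsCompact K ∧ K.Nonempty

/-- Hausdorff closeness -/
def HClose (δ : ℝ) (K L : Set E) : Prop :=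
  (∀ x ∈ K, ∃ y ∈ L, dist x y ≤ δ) ∧ (∀ y ∈ L, ∃ x ∈ K, dist x y ≤ δ)

/-- simple continuous translation invariant valuations, as set functions -/
structure SV (m : Set E → ℂ) : Prop where
  empty : m ∅ = 0
  val : ∀ K L, IsBody K → IsBody L → IsBody (K ∪ L) → IsBody (K ∩ L) →
    m (K ∪ L) + m (K ∩ L) = m K + m L
  cont : ∀ K, IsBody K → ∀ ε > 0, ∃ δ > 0, ∀ L, IsBody L → HClose δ K L → ‖m L - m K‖ < ε
  trans : ∀ x K, IsBody K → m ({x} + K) = m K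
  simple : ∀ K u c, IsBody K → u ≠ 0 → (∀ x ∈ K, inner ℝ u x = c) → m K = 0

/-- parity -/
def Par (σ : ℂ) (m : Set E → ℂ) : Prop := ∀ K, IsBody K → m (-K) = σ * m K

theorem IsBody.add {K L : Set E} (hK : IsBody K) (hL : IsBody L) : IsBody (K + L) :=
  ⟨hK.1.add hL.1, hK.2.1.add hL.2.1, hK.2.2.add hL.2.2⟩

theorem IsBody.neg {K : Set E} (hK : IsBody K) : IsBody (-K) :=
  ⟨hK.1.neg, hK.2.1.neg, hK.2.2.neg⟩

theorem IsBody.smul {K : Set E} (hK : IsBody K) (t : ℝ) : IsBody (t • K) :=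
  ⟨hK.1.smul t, hK.2.1.smul t, hK.2.2.smul_set⟩

theorem isBody_singleton (x : E) : IsBody ({x} : Set E) :=
  ⟨convex_singleton x, isCompact_singleton, singleton_nonempty x⟩

theorem IsBody.isClosed {K : Set E} (hK : IsBody K) : IsClosed K := hK.2.1.isClosed

/-- the segment `[0, v]` -/
def sg (v : E) : Set E := (fun s : ℝ => s • v) '' Icc 0 1

theorem mem_sg {v x : E} : x ∈ sg v ↔ ∃ s : ℝ, 0 ≤ s ∧ s ≤ 1 ∧ s • v = x := by
  simp [sg, and_assoc]

theorem isBody_sg (v : E) : IsBody (sg v) := by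
  refine ⟨?_, ?_, ⟨0, mem_sg.2 ⟨0, le_rfl, zero_le_one, by simp⟩⟩⟩
  · have : sg v = (LinearMap.toSpanSingleton ℝ E v) '' Icc 0 1 := by
      ext x; simp [sg]
    rw [this]
    exact (convex_Icc 0 1).linear_image _
  · exact isCompact_Icc.image (by fun_prop)

theorem mem_singleton_add {x y : E} {K : Set E} : y ∈ ({x} : Set E) + K ↔ ∃ k ∈ K, x + k = y := by
  simp only [Set.singleton_add, mem_image]

theorem exists_inter {K L : Set E} (hK : IsClosed K) (hL : IsClosed L) (hc : Convex ℝ (K ∪ L))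
    {k l : E} (hk : k ∈ K) (hl : l ∈ L) :
    ∃ θ : ℝ, 0 ≤ θ ∧ θ ≤ 1 ∧ k + θ • (l - k) ∈ K ∩ L := by
  have h := isPreconnected_closed_iff.1 (isPreconnected_Icc (a := (0:ℝ)) (b := 1))
    ((fun θ : ℝ => k + θ • (l - k)) ⁻¹' K) ((fun θ : ℝ => k + θ • (l - k)) ⁻¹' L)
    (hK.preimage (by fun_prop)) (hL.preimage (by fun_prop)) ?_ ⟨0, by simp, by simpa⟩
    ⟨1, by simp, by simpa⟩
  · obtain ⟨θ, hθ, h1, h2⟩ := h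
    exact ⟨θ, hθ.1, hθ.2, h1, h2⟩
  · intro θ hθ
    have := hc (Or.inl hk) (Or.inr hl) (sub_nonneg.2 hθ.2) hθ.1 (by ring)
    have e : (1 - θ) • k + θ • l = k + θ • (l - k) := by module
    rw [e] at this
    exact this

theorem isClosed_le_inner (u : E) (c : ℝ) : IsClosed {x : E | inner ℝ u x ≤ c} :=
  isClosed_le (by fun_prop) (by fun_prop)

theorem isClosed_ge_inner (u : E) (c : ℝ) : IsClosed {x : E | c ≤ inner ℝ u x} :=
  isClosed_le (by fun_prop) (by fun_prop)

theorem convex_le_inner (u : E) (c : ℝ) : Convex ℝ {x : E | inner ℝ u x ≤ c} :=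
  convex_halfSpace_le (innerₛₗ ℝ u).isLinear c

theorem convex_ge_inner (u : E) (c : ℝ) : Convex ℝ {x : E | c ≤ inner ℝ u x} :=
  convex_halfSpace_ge (innerₛₗ ℝ u).isLinear c

theorem SV.cut {m : Set E → ℂ} (hm : SV m) {A : Set E} (hA : Convex ℝ A) (hA' : IsCompact A)
    {u : E} (hu : u ≠ 0) (c : ℝ) :
    m A = m (A ∩ {x | inner ℝ u x ≤ c}) + m (A ∩ {x | c ≤ inner ℝ u x}) := by
  set K := A ∩ {x | inner ℝ u x ≤ c} with hKd
  set L := A ∩ {x | c ≤ inner ℝ u x} with hLd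
  have hun : K ∪ L = A := by
    rw [hKd, hLd, ← inter_union_distrib_left, inter_eq_left]
    intro x _
    exact le_total (inner ℝ u x) c
  rcases K.eq_empty_or_nonempty with hKe | hKn
  · rw [hKe, empty_union] at hun
    rw [hKe, hm.empty, hun, zero_add]
  rcases L.eq_empty_or_nonempty with hLe | hLn
  · rw [hLe, union_empty] at hun
    rw [hLe, hm.empty, hun, add_zero]
  have bK : IsBody K := ⟨hA.inter (convex_le_inner _ _), hA'.inter_right (isClosed_le_inner _ _), hKn⟩
  have bL : IsBody L := ⟨hA.inter (convex_ge_inner _ _), hA'.inter_right (isClosed_ge_inner _ _), hLn⟩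
  obtain ⟨k, hk⟩ := hKn
  obtain ⟨l, hl⟩ := hLn
  obtain ⟨θ, -, -, hθ⟩ := exists_inter bK.isClosed bL.isClosed (by rwa [hun]) hk hl
  have bI : IsBody (K ∩ L) := ⟨bK.1.inter bL.1, bK.2.1.inter_right bL.isClosed, ⟨_, hθ⟩⟩
  have h := hm.val K L bK bL (by rw [hun]; exact ⟨hA, hA', ⟨k, hk.1⟩⟩) bI
  rw [hm.simple _ u c bI hu (fun x hx => le_antisymm hx.1.2 hx.2.2), add_zero, hun] at h
  exact h

theorem HClose.symm {δ : ℝ} {K L : Set E} (h : HClose δ K L) : HClose δ L K :=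
  ⟨fun x hx => by obtain ⟨y, hy, h'⟩ := h.2 x hx; exact ⟨y, hy, by rwa [dist_comm]⟩,
   fun x hx => by obtain ⟨y, hy, h'⟩ := h.1 x hx; exact ⟨y, hy, by rwa [dist_comm]⟩⟩

theorem HClose.mono {δ δ' : ℝ} {K L : Set E} (h : HClose δ K L) (hd : δ ≤ δ') : HClose δ' K L :=
  ⟨fun x hx => by obtain ⟨y, hy, h'⟩ := h.1 x hx; exact ⟨y, hy, h'.trans hd⟩,
   fun x hx => by obtain ⟨y, hy, h'⟩ := h.2 x hx; exact ⟨y, hy, h'.trans hd⟩⟩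

theorem HClose.add {δ : ℝ} {K L : Set E} (h : HClose δ K L) (Z : Set E) :
    HClose δ (K + Z) (L + Z) := by
  constructor
  · rintro _ ⟨k, hk, z, hz, rfl⟩
    obtain ⟨y, hy, h'⟩ := h.1 k hk
    exact ⟨y + z, ⟨y, hy, z, hz, rfl⟩, by simpa using h'⟩
  · rintro _ ⟨k, hk, z, hz, rfl⟩
    obtain ⟨y, hy, h'⟩ := h.2 k hk
    exact ⟨y + z, ⟨y, hy, z, hz, rfl⟩, by simpa using h'⟩

theorem HClose.smul {δ : ℝ} {K L : Set E} (h : HClose δ K L) {t : ℝ} (ht : 0 ≤ t) :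
    HClose (t * δ) (t • K) (t • L) := by
  constructor
  · rintro _ ⟨k, hk, rfl⟩
    obtain ⟨y, hy, h'⟩ := h.1 k hk
    refine ⟨t • y, ⟨y, hy, rfl⟩, ?_⟩
    simp only [dist_smul₀, Real.norm_eq_abs, abs_of_nonneg ht]
    gcongr
  · rintro _ ⟨k, hk, rfl⟩
    obtain ⟨y, hy, h'⟩ := h.2 k hk
    refine ⟨t • y, ⟨y, hy, rfl⟩, ?_⟩
    simp only [dist_smul₀, Real.norm_eq_abs, abs_of_nonneg ht]
    gcongr

/-- If `m` vanishes on arbitrarily close bodies it vanishes. -/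
theorem SV.eq_zero_of_close {m : Set E → ℂ} (hm : SV m) {K : Set E} (hK : IsBody K)
    (h : ∀ δ > 0, ∃ L, IsBody L ∧ HClose δ K L ∧ m L = 0) : m K = 0 := by
  by_contra hne
  obtain ⟨δ, hδ, h1⟩ := hm.cont K hK ‖m K‖ (norm_pos_iff.2 hne)
  obtain ⟨L, hL, hKL, h0⟩ := h δ hδ
  have := h1 L hL hKL
  rw [h0, zero_sub, norm_neg] at this
  exact lt_irrefl _ this

/-- linear combinations -/
theorem SV.lin {m m' : Set E → ℂ} (hm : SV m) (hm' : SV m') (a b : ℂ) :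
    SV (fun K => a * m K + b * m' K) where
  empty := by simp [hm.empty, hm'.empty]
  val K L hK hL hU hI := by
    have h1 := hm.val K L hK hL hU hI
    have h2 := hm'.val K L hK hL hU hI
    linear_combination a * h1 + b * h2
  cont K hK ε hε := by
    have ha : 0 < ‖a‖ + ‖b‖ + 1 := by positivity
    obtain ⟨δ, hδ, h1⟩ := hm.cont K hK (ε / (‖a‖ + ‖b‖ + 1)) (by positivity)
    obtain ⟨δ', hδ', h2⟩ := hm'.cont K hK (ε / (‖a‖ + ‖b‖ + 1)) (by positivity)
    refine ⟨min δ δ', lt_min hδ hδ', fun L hL hKL => ?_⟩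
    have e1 := h1 L hL (hKL.mono (min_le_left _ _))
    have e2 := h2 L hL (hKL.mono (min_le_right _ _))
    have e : a * m L + b * m' L - (a * m K + b * m' K) = a * (m L - m K) + b * (m' L - m' K) := by
      ring
    rw [e]
    calc _ ≤ ‖a * (m L - m K)‖ + ‖b * (m' L - m' K)‖ := norm_add_le _ _
      _ = ‖a‖ * ‖m L - m K‖ + ‖b‖ * ‖m' L - m' K‖ := by simp
      _ ≤ ‖a‖ * (ε / (‖a‖ + ‖b‖ + 1)) + ‖b‖ * (ε / (‖a‖ + ‖b‖ + 1)) := by gcongr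
      _ = (‖a‖ + ‖b‖) * (ε / (‖a‖ + ‖b‖ + 1)) := by ring
      _ < (‖a‖ + ‖b‖ + 1) * (ε / (‖a‖ + ‖b‖ + 1)) := by
        apply mul_lt_mul_of_pos_right _ (by positivity)
        linarith
      _ = ε := by field_simp
  trans x K hK := by rw [hm.trans x K hK, hm'.trans x K hK]
  simple K u c hK hu h := by rw [hm.simple K u c hK hu h, hm'.simple K u c hK hu h]; simp

theorem SV.dil {m : Set E → ℂ} (hm : SV m) {t : ℝ} (ht : 0 < t) : SV (fun K => m (t • K)) where
  empty := by simp [hm.empty]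
  val K L hK hL hU hI := by
    have := hm.val (t • K) (t • L) (hK.smul t) (hL.smul t)
      (by rw [← smul_set_union]; exact hU.smul t) (by rw [← smul_set_inter₀ ht.ne']; exact hI.smul t)
    rwa [← smul_set_union, ← smul_set_inter₀ ht.ne'] at this
  cont K hK ε hε := by
    obtain ⟨δ, hδ, h1⟩ := hm.cont (t • K) (hK.smul t) ε hε
    refine ⟨δ / t, by positivity, fun L hL hKL => h1 _ (hL.smul t) ?_⟩
    have := hKL.smul ht.le
    rwa [mul_div_cancel₀ _ ht.ne'] at this
  trans x K hK := by
    have := hm.trans (t • x) (t • K) (hK.smul t)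
    rwa [← smul_set_singleton, ← smul_add] at this
  simple K u c hK hu h := by
    refine hm.simple (t • K) u (t * c) (hK.smul t) hu ?_
    rintro _ ⟨x, hx, rfl⟩
    simp [inner_smul_right, h x hx]

end Basics


section Reduction

variable {E : Type*} [NormedAddCommGroup E] [InnerProductSpace ℝ E]

/-- a polyhedron given by a list of half-spaces -/
def HPoly (l : List (E × ℝ)) : Set E := {x | ∀ p ∈ l, inner ℝ p.1 x ≤ p.2}

theorem convex_poly (l : List (E × ℝ)) : Convex ℝ (HPoly l) := by
  have : HPoly l = ⋂ p ∈ l, {x | inner ℝ p.1 x ≤ p.2} := by ext; simp [HPoly]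
  rw [this]
  exact convex_iInter₂ fun p _ => convex_le_inner _ _

theorem isClosed_poly (l : List (E × ℝ)) : IsClosed (HPoly l) := by
  have : HPoly l = ⋂ p ∈ l, {x | inner ℝ p.1 x ≤ p.2} := by ext; simp [HPoly]
  rw [this]
  exact isClosed_biInter fun p _ => isClosed_le_inner _ _

theorem poly_nil : HPoly ([] : List (E × ℝ)) = univ := by ext; simp [HPoly]

theorem poly_cons (p : E × ℝ) (l : List (E × ℝ)) :
    HPoly (p :: l) = {x | inner ℝ p.1 x ≤ p.2} ∩ HPoly l := by ext; simp [HPoly]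

theorem poly_append (l l' : List (E × ℝ)) : HPoly (l ++ l') = HPoly l ∩ HPoly l' := by
  ext; simp [HPoly, or_imp, forall_and]

theorem SV.merge {m : Set E → ℂ} (hm : SV m) (A : Set E) (hA : Convex ℝ A) (N U : Set (E × ℝ))
    (hd : ∀ p ∈ U, ∀ q ∈ U, (p.1 - q.1, p.2 - q.2) ∈ N)
    (h0 : ∀ l : List (E × ℝ), (∀ p ∈ l, p ∈ N) → IsCompact (A ∩ HPoly l) → m (A ∩ HPoly l) = 0)
    (h1 : ∀ l : List (E × ℝ), (∀ p ∈ l, p ∈ N) → ∀ p ∈ U, IsCompact (A ∩ HPoly (p :: l)) →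
      m (A ∩ HPoly (p :: l)) = 0) :
    ∀ k : ℕ, ∀ l' : List (E × ℝ), l'.length = k → (∀ p ∈ l', p ∈ U) →
      ∀ l : List (E × ℝ), (∀ p ∈ l, p ∈ N) →
      IsCompact (A ∩ HPoly (l' ++ l)) → m (A ∩ HPoly (l' ++ l)) = 0 := by
  intro k
  induction k with
  | zero =>
    intro l' hl' _ l hl hc
    rw [List.length_eq_zero_iff] at hl'
    subst hl'
    exact h0 l hl hc
  | succ k ih =>
    intro l' hl' hU l hl hc
    match l', hl', hU, hc with
    | [p], _, hU, hc => exact h1 l hl p (hU p (by simp)) hc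
    | p :: q :: r, hl', hU, hc =>
      have hpU := hU p (by simp)
      have hqU := hU q (by simp)
      have hrU : ∀ x ∈ r, x ∈ U := fun x hx => hU x (by simp [hx])
      simp only [List.length_cons] at hl'
      by_cases hpq : p.1 = q.1
      · rcases le_total p.2 q.2 with h | h
        · have e : HPoly (p :: q :: r ++ l) = HPoly ((p :: r) ++ l) := by
            ext x
            simp only [HPoly, List.cons_append, List.mem_cons, forall_eq_or_imp, mem_setOf_eq]
            constructor
            · rintro ⟨a, b, c⟩; exact ⟨a, c⟩
            · rintro ⟨a, c⟩; exact ⟨a, by rw [← hpq]; linarith, c⟩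
          rw [e] at hc ⊢
          refine ih (p :: r) (by simp only [List.length_cons]; omega) ?_ l hl hc
          simpa [hpU] using hrU
        · have e : HPoly (p :: q :: r ++ l) = HPoly ((q :: r) ++ l) := by
            ext x
            simp only [HPoly, List.cons_append, List.mem_cons, forall_eq_or_imp, mem_setOf_eq]
            constructor
            · rintro ⟨a, b, c⟩; exact ⟨b, c⟩
            · rintro ⟨a, c⟩; exact ⟨by rw [hpq]; linarith, a, c⟩
          rw [e] at hc ⊢
          refine ih (q :: r) (by simp only [List.length_cons]; omega) ?_ l hl hc
          simpa [hqU] using hrU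
      · have hu : q.1 - p.1 ≠ 0 := sub_ne_zero.2 (Ne.symm hpq)
        have hcut := hm.cut (hA.inter (convex_poly _)) hc hu (q.2 - p.2)
        have e1 : A ∩ HPoly (p :: q :: r ++ l) ∩ {x | inner ℝ (q.1 - p.1) x ≤ q.2 - p.2} =
            A ∩ HPoly ((p :: r) ++ ((q.1 - p.1, q.2 - p.2) :: l)) := by
          ext x
          simp only [poly_append, poly_cons, mem_inter_iff, mem_setOf_eq, List.cons_append,
            inner_sub_left]
          constructor
          · rintro ⟨⟨a, b, c, d, e⟩, f⟩; exact ⟨a, b, d, f, e⟩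
          · rintro ⟨a, b, d, f, e⟩; exact ⟨⟨a, b, by linarith, d, e⟩, f⟩
        have e2 : A ∩ HPoly (p :: q :: r ++ l) ∩ {x | q.2 - p.2 ≤ inner ℝ (q.1 - p.1) x} =
            A ∩ HPoly ((q :: r) ++ ((p.1 - q.1, p.2 - q.2) :: l)) := by
          ext x
          simp only [poly_append, poly_cons, mem_inter_iff, mem_setOf_eq, List.cons_append,
            inner_sub_left]
          constructor
          · rintro ⟨⟨a, b, c, d, e⟩, f⟩; exact ⟨a, c, d, by linarith, e⟩
          · rintro ⟨a, b, d, f, e⟩; exact ⟨⟨a, by linarith, b, d, e⟩, by linarith⟩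
        have c1 := hc.inter_right (isClosed_le_inner (q.1 - p.1) (q.2 - p.2))
        have c2 := hc.inter_right (isClosed_ge_inner (q.1 - p.1) (q.2 - p.2))
        rw [e1] at hcut c1
        rw [e2] at hcut c2
        rw [hcut, ih (p :: r) (by simp only [List.length_cons]; omega) (by simpa [hpU] using hrU)
          _ (by simpa [hd q hqU p hpU] using hl) c1,
          ih (q :: r) (by simp only [List.length_cons]; omega) (by simpa [hqU] using hrU)
          _ (by simpa [hd p hpU q hqU] using hl) c2, add_zero]

theorem mem_cthickening_of_infDist_le {K : Set E} (hK : K.Nonempty) {x : E} {δ : ℝ}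
    (h : infDist x K ≤ δ) : x ∈ cthickening δ K := by
  rw [mem_cthickening_iff]
  exact ENNReal.le_ofReal_iff_toReal_le (infEDist_ne_top hK)
    (infDist_nonneg.trans h) |>.2 h

theorem exists_poly_close [FiniteDimensional ℝ E] {K : Set E} (hK : IsBody K) {δ : ℝ} (hδ : 0 < δ) :
    ∃ l : List (E × ℝ), IsBody (HPoly l) ∧ K ⊆ HPoly l ∧ HClose δ K (HPoly l) := by
  set S : Set E := {x | infDist x K = δ} with hS
  have hSc : IsCompact S := by
    refine Metric.isCompact_of_isClosed_isBounded
      (isClosed_eq (continuous_infDist_pt K) continuous_const) ?_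
    refine (hK.2.1.isBounded.cthickening (δ := δ)).subset ?_
    intro x hx
    refine mem_cthickening_of_infDist_le hK.2.2 ?_
    exact le_of_eq hx
  have hsep : ∀ x ∈ S, ∃ p : E × ℝ, K ⊆ {y | inner ℝ p.1 y ≤ p.2} ∧ p.2 < inner ℝ p.1 x := by
    intro x hx
    have hxK : x ∉ K := by
      intro h
      have := infDist_zero_of_mem h
      rw [hS, mem_setOf_eq] at hx
      linarith
    obtain ⟨f, u, h1, h2⟩ := geometric_hahn_banach_closed_point hK.1 hK.isClosed hxK
    refine ⟨((InnerProductSpace.toDual ℝ E).symm f, u), ?_, ?_⟩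
    · intro y hy
      simpa using (h1 y hy).le
    · simpa using h2
  choose! p hp1 hp2 using hsep
  obtain ⟨t, htS, ht⟩ := hSc.elim_nhds_subcover (fun x => {y | (p x).2 < inner ℝ (p x).1 y})
    (fun x hx => (isOpen_lt (by fun_prop) (by fun_prop)).mem_nhds (hp2 x hx))
  set l := t.toList.map p with hl
  have hKl : K ⊆ HPoly l := by
    intro y hy q hq
    simp only [hl, List.mem_map, Finset.mem_toList] at hq
    obtain ⟨x, hx, rfl⟩ := hq
    exact hp1 x (htS x hx) hy
  have hmiss : ∀ y ∈ HPoly l, y ∉ S := by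
    intro y hy hyS
    obtain ⟨x, hx, hxy⟩ := mem_iUnion₂.1 (ht hyS)
    have := hy (p x) (by simp only [hl, List.mem_map, Finset.mem_toList]; exact ⟨x, hx, rfl⟩)
    rw [mem_setOf_eq] at hxy
    linarith
  obtain ⟨k, hk⟩ := hK.2.2
  have hlt : ∀ y ∈ HPoly l, infDist y K < δ := by
    intro y hy
    by_contra hge
    push Not at hge
    have hpre := ((convex_poly l).isPreconnected).intermediate_value (hKl hk) hy
      (f := fun x => infDist x K) (continuous_infDist_pt K).continuousOn
    have hin : δ ∈ Icc (infDist k K) (infDist y K) := by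
      rw [infDist_zero_of_mem hk]; exact ⟨hδ.le, hge⟩
    obtain ⟨z, hz, hz'⟩ := hpre hin
    exact hmiss z hz hz'
  refine ⟨l, ⟨convex_poly l, ?_, ⟨k, hKl hk⟩⟩, hKl, ?_, ?_⟩
  · refine Metric.isCompact_of_isClosed_isBounded (isClosed_poly l) ?_
    refine (hK.2.1.isBounded.cthickening (δ := δ)).subset ?_
    intro x hx
    refine mem_cthickening_of_infDist_le hK.2.2 ?_
    exact (hlt x hx).le
  · intro x hx
    exact ⟨x, hKl hx, by simpa using hδ.le⟩
  · intro y hy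
    obtain ⟨x, hx, hxy⟩ := (infDist_lt_iff hK.2.2).1 (hlt y hy)
    exact ⟨x, hx, by rw [dist_comm]; exact hxy.le⟩

theorem SV.eq_zero_of_poly [FiniteDimensional ℝ E] {m : Set E → ℂ} (hm : SV m)
    (h : ∀ l : List (E × ℝ), IsBody (HPoly l) → m (HPoly l) = 0) {K : Set E} (hK : IsBody K) :
    m K = 0 := by
  refine hm.eq_zero_of_close hK fun δ hδ => ?_
  obtain ⟨l, h1, -, h2⟩ := exists_poly_close hK hδ
  exact ⟨HPoly l, h1, h2, h l h1⟩

theorem not_isCompact_of_ray {A : Set E} {x v : E} (hv : v ≠ 0)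
    (h : ∀ s : ℝ, 0 ≤ s → x + s • v ∈ A) : ¬ IsCompact A := by
  intro hA
  obtain ⟨R, hR⟩ := hA.isBounded.subset_closedBall (0 : E)
  have hv' : 0 < ‖v‖ := norm_pos_iff.2 hv
  have h2 := hR (h ((|R| + ‖x‖ + 1) / ‖v‖) (by positivity))
  rw [mem_closedBall_zero_iff] at h2
  have h3 : ‖((|R| + ‖x‖ + 1) / ‖v‖) • v‖ = |R| + ‖x‖ + 1 := by
    rw [norm_smul, Real.norm_eq_abs, abs_of_nonneg (by positivity)]
    field_simp
  have h4 := norm_sub_le (x + ((|R| + ‖x‖ + 1) / ‖v‖) • v) x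
  rw [add_sub_cancel_left, h3] at h4
  have := le_abs_self R
  linarith

/-- rescale a constraint -/
theorem scale_constraint {u x : E} {c a : ℝ} (ha : 0 < a) :
    inner ℝ (a⁻¹ • u) x ≤ a⁻¹ * c ↔ inner ℝ u x ≤ c := by
  rw [real_inner_smul_left]
  exact mul_le_mul_iff_right₀ (inv_pos.2 ha)

/-- Reduction to bodies with one upper and one lower constraint in direction `v`. -/
theorem SV.reduce_vert [FiniteDimensional ℝ E] {m : Set E → ℂ} (hm : SV m) {v : E} (hv : v ≠ 0)
    (h : ∀ (p q : E × ℝ) (l : List (E × ℝ)), inner ℝ p.1 v = 1 → inner ℝ q.1 v = -1 →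
      (∀ r ∈ l, inner ℝ r.1 v = 0) → IsBody ({x | inner ℝ p.1 x ≤ p.2} ∩ HPoly (q :: l)) →
      m ({x | inner ℝ p.1 x ≤ p.2} ∩ HPoly (q :: l)) = 0)
    {K : Set E} (hK : IsBody K) : m K = 0 := by
  refine hm.eq_zero_of_poly (fun l hl => ?_) hK
  have hsplit : ∀ l : List (E × ℝ), ∃ l1 l2 l3 : List (E × ℝ), (∀ r ∈ l1, inner ℝ r.1 v = 1) ∧
      (∀ r ∈ l2, inner ℝ r.1 v = -1) ∧ (∀ r ∈ l3, inner ℝ r.1 v = 0) ∧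
      HPoly l = HPoly (l1 ++ (l2 ++ l3)) := by
    intro l
    induction l with
    | nil => exact ⟨[], [], [], by simp, by simp, by simp, rfl⟩
    | cons p l ih =>
      obtain ⟨l1, l2, l3, h1, h2, h3, h4⟩ := ih
      rcases lt_trichotomy (inner ℝ p.1 v) 0 with hp | hp | hp
      · have hp' : 0 < - inner ℝ p.1 v := by linarith
        refine ⟨l1, ((-inner ℝ p.1 v)⁻¹ • p.1, (-inner ℝ p.1 v)⁻¹ * p.2) :: l2, l3, h1, ?_, h3, ?_⟩
        · simp only [List.mem_cons, forall_eq_or_imp]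
          refine ⟨?_, h2⟩
          rw [real_inner_smul_left, inv_neg, neg_mul, inv_mul_cancel₀ hp.ne]
        · ext x
          simp only [poly_append, poly_cons, mem_inter_iff, mem_setOf_eq, List.cons_append,
            scale_constraint hp', h4]
          tauto
      · refine ⟨l1, l2, p :: l3, h1, h2, by simpa [hp] using h3, ?_⟩
        ext x
        simp only [poly_append, poly_cons, mem_inter_iff, mem_setOf_eq, h4]
        tauto
      · refine ⟨((inner ℝ p.1 v)⁻¹ • p.1, (inner ℝ p.1 v)⁻¹ * p.2) :: l1, l2, l3, ?_, h2, h3, ?_⟩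
        · simp only [List.mem_cons, forall_eq_or_imp]
          refine ⟨?_, h1⟩
          rw [real_inner_smul_left]
          field_simp
        · ext x
          simp only [poly_append, poly_cons, mem_inter_iff, mem_setOf_eq, List.cons_append,
            scale_constraint hp, h4]
  obtain ⟨l1, l2, l3, h1, h2, h3, h4⟩ := hsplit l
  have hlow : ∀ p : E × ℝ, inner ℝ p.1 v = 1 → ∀ l2 l3 : List (E × ℝ),
      (∀ r ∈ l2, inner ℝ r.1 v = -1) → (∀ r ∈ l3, inner ℝ r.1 v = 0) →
      IsCompact ({x | inner ℝ p.1 x ≤ p.2} ∩ HPoly (l2 ++ l3)) →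
      m ({x | inner ℝ p.1 x ≤ p.2} ∩ HPoly (l2 ++ l3)) = 0 := by
    intro p hp l2 l3 h2 h3 hc
    refine hm.merge {x | inner ℝ p.1 x ≤ p.2} (convex_le_inner _ _) {r | inner ℝ r.1 v = 0}
      {r | inner ℝ r.1 v = -1} ?_ ?_ ?_ _ l2 rfl h2 l3 h3 hc
    · intro r hr s hs
      simp only [mem_setOf_eq] at hr hs ⊢
      rw [inner_sub_left, hr, hs, sub_self]
    · intro l hl hc
      rcases (({x | inner ℝ p.1 x ≤ p.2} ∩ HPoly l)).eq_empty_or_nonempty with he | ⟨x, hx⟩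
      · rw [he, hm.empty]
      · refine absurd hc (not_isCompact_of_ray (x := x) (v := -v) (neg_ne_zero.2 hv) ?_)
        intro s hs
        refine ⟨?_, ?_⟩
        · have := hx.1
          simp only [mem_setOf_eq] at this ⊢
          rw [inner_add_right, inner_smul_right, inner_neg_right, hp]
          linarith
        · intro r hr
          have := hx.2 r hr
          rw [inner_add_right, inner_smul_right, inner_neg_right, hl r hr]
          linarith
    · intro l hl q hq hc
      rcases (({x | inner ℝ p.1 x ≤ p.2} ∩ HPoly (q :: l))).eq_empty_or_nonempty with he | hne
      · rw [he, hm.empty]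
      · exact h p q l hp hq hl ⟨(convex_le_inner _ _).inter (convex_poly _), hc, hne⟩
  rw [h4] at hl ⊢
  have := hm.merge univ convex_univ {r | inner ℝ r.1 v = -1 ∨ inner ℝ r.1 v = 0}
      {r | inner ℝ r.1 v = 1} ?_ ?_ ?_ _ l1 rfl h1 (l2 ++ l3) ?_ ?_
  · rwa [univ_inter] at this
  · intro r hr s hs
    simp only [mem_setOf_eq] at hr hs ⊢
    rw [inner_sub_left, hr, hs, sub_self]
    simp
  · intro l hl hc
    rw [univ_inter] at hc ⊢
    rcases (HPoly l).eq_empty_or_nonempty with he | ⟨x, hx⟩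
    · rw [he, hm.empty]
    · refine absurd hc (not_isCompact_of_ray (x := x) hv ?_)
      intro s hs r hr
      have := hx r hr
      rw [inner_add_right, inner_smul_right]
      rcases hl r hr with h' | h' <;> rw [h'] <;> linarith
  · intro l hl p hp hc
    have hs2 : ∀ l : List (E × ℝ), (∀ r ∈ l, r ∈ {r : E × ℝ | inner ℝ r.1 v = -1 ∨ inner ℝ r.1 v = 0})
        → ∃ l2 l3 : List (E × ℝ), (∀ r ∈ l2, inner ℝ r.1 v = -1) ∧ (∀ r ∈ l3, inner ℝ r.1 v = 0) ∧
        HPoly l = HPoly (l2 ++ l3) := by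
      intro l
      induction l with
      | nil => exact fun _ => ⟨[], [], by simp, by simp, rfl⟩
      | cons p l ih =>
        intro hh
        obtain ⟨l2, l3, h2, h3, h4⟩ := ih (fun r hr => hh r (by simp [hr]))
        rcases hh p (by simp) with hp | hp
        · refine ⟨p :: l2, l3, by simpa [hp] using h2, h3, ?_⟩
          rw [List.cons_append, poly_cons, poly_cons, h4]
        · refine ⟨l2, p :: l3, h2, by simpa [hp] using h3, ?_⟩
          ext x
          simp only [poly_append, poly_cons, mem_inter_iff, mem_setOf_eq, h4]
          tauto
    obtain ⟨l2, l3, h2, h3, h4⟩ := hs2 l hl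
    rw [univ_inter, poly_cons, h4] at hc ⊢
    exact hlow p hp l2 l3 h2 h3 hc
  · intro r hr
    rcases List.mem_append.1 hr with hr | hr
    · exact Or.inl (h2 r hr)
    · exact Or.inr (h3 r hr)
  · rw [univ_inter]; exact hl.2.1

/-- Reduction to truncated cones. -/
theorem SV.reduce_cone [FiniteDimensional ℝ E] {m : Set E → ℂ} (hm : SV m) {v : E} (hv : v ≠ 0)
    (h : ∀ (u : E) (l : List (E × ℝ)), (∀ r ∈ l, r.2 = 0) → 
      IsBody (HPoly ((u, 1) :: l)) → m (HPoly ((u, 1) :: l)) = 0)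
    {K : Set E} (hK : IsBody K) : m K = 0 := by
  refine hm.eq_zero_of_poly (fun l hl => ?_) hK
  obtain ⟨x0, hx0⟩ := hl.2.2
  have htr : ∃ l' : List (E × ℝ), {-x0} + HPoly l = HPoly l' ∧ ∀ r ∈ l', 0 ≤ r.2 := by
    refine ⟨l.map (fun r => (r.1, r.2 - inner ℝ r.1 x0)), ?_, ?_⟩
    · ext x
      rw [mem_singleton_add]
      simp only [HPoly, mem_setOf_eq, List.mem_map, forall_exists_index, and_imp,
        forall_apply_eq_imp_iff₂]
      constructor
      · rintro ⟨k, hk, rfl⟩ r hr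
        rw [inner_add_right, inner_neg_right]
        linarith [hk r hr]
      · intro hx
        refine ⟨x + x0, fun r hr => ?_, by abel⟩
        rw [inner_add_right]
        linarith [hx r hr]
    · simp only [List.mem_map, forall_exists_index, and_imp, forall_apply_eq_imp_iff₂]
      intro r hr
      have := hx0 r hr
      linarith
  obtain ⟨l', he, hl'⟩ := htr
  have hb := (isBody_singleton (-x0)).add hl
  rw [← hm.trans (-x0) _ hl]
  rw [he] at hb ⊢
  have hsplit : ∀ l : List (E × ℝ), (∀ r ∈ l, 0 ≤ r.2) → ∃ l1 l2 : List (E × ℝ),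
      (∀ r ∈ l1, r.2 = 1) ∧ (∀ r ∈ l2, r.2 = 0) ∧ HPoly l = HPoly (l1 ++ l2) := by
    intro l
    induction l with
    | nil => exact fun _ => ⟨[], [], by simp, by simp, rfl⟩
    | cons p l ih =>
      intro hh
      obtain ⟨l1, l2, h1, h2, h4⟩ := ih (fun r hr => hh r (by simp [hr]))
      rcases (hh p (by simp)).eq_or_lt' with hp | hp
      · refine ⟨l1, p :: l2, h1, by simpa [hp] using h2, ?_⟩
        ext x
        simp only [poly_append, poly_cons, mem_inter_iff, mem_setOf_eq, h4]
        tauto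
      · refine ⟨(p.2⁻¹ • p.1, p.2⁻¹ * p.2) :: l1, l2, ?_, h2, ?_⟩
        · simp only [List.mem_cons, forall_eq_or_imp]
          exact ⟨inv_mul_cancel₀ hp.ne', h1⟩
        · ext x
          simp only [poly_append, poly_cons, mem_inter_iff, mem_setOf_eq, List.cons_append,
            scale_constraint hp, h4]
  obtain ⟨l1, l2, h1, h2, h3⟩ := hsplit l' hl'
  rw [h3] at hb ⊢
  have := hm.merge univ convex_univ {r | r.2 = 0} {r | r.2 = 1} ?_ ?_ ?_ _ l1 rfl h1 l2 h2 ?_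
  · rwa [univ_inter] at this
  · intro r hr s hs
    simp only [mem_setOf_eq] at hr hs ⊢
    rw [hr, hs, sub_self]
  · intro l hl hc
    rw [univ_inter] at hc ⊢
    have : HPoly l = {0} := by
      ext x
      constructor
      · intro hx
        by_contra hne
        refine absurd hc (not_isCompact_of_ray (x := 0) (v := x) hne ?_)
        intro s hs r hr
        have h1 := hx r hr
        have h2 : r.2 = 0 := hl r hr
        rw [h2] at h1 ⊢
        rw [zero_add, inner_smul_right]
        exact mul_nonpos_of_nonneg_of_nonpos hs h1
      · rintro rfl r hr
        rw [inner_zero_right, hl r hr]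
    rw [this]
    refine hm.simple _ v 0 (isBody_singleton 0) hv ?_
    simp
  · intro l hl p hp hc
    rw [univ_inter] at hc ⊢
    obtain ⟨u, c⟩ := p
    have hp : c = 1 := hp
    subst hp
    refine h u l hl ⟨convex_poly _, hc, 0, ?_⟩
    intro r hr
    rw [inner_zero_right]
    rcases List.mem_cons.1 hr with rfl | hr
    · exact zero_le_one
    · exact (hl r hr).ge
  · rw [univ_inter]; exact hb.2.1

end Reduction


section Regions

variable {E : Type*} [NormedAddCommGroup E] [InnerProductSpace ℝ E] [FiniteDimensional ℝ E]

/-- orthogonal hyperplane -/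
abbrev Hp (v : E) : Submodule ℝ E := (ℝ ∙ v)ᗮ

/-- projection -/
def pr (v : E) : E →L[ℝ] Hp v := (Hp v).orthogonalProjectionOnto

theorem inner_Hp {v : E} (y : Hp v) : inner ℝ v (y : E) = 0 :=
  Submodule.mem_orthogonal_singleton_iff_inner_right.1 y.2

theorem inner_Hp' {v : E} (y : Hp v) : inner ℝ (y : E) v = 0 :=
  Submodule.mem_orthogonal_singleton_iff_inner_left.1 y.2

theorem pr_add {v : E} (y : Hp v) (s : ℝ) : pr v ((y : E) + s • v) = y := by
  have : pr v v = 0 := Submodule.orthogonalProjectionOnto_orthogonalComplement_singleton_eq_zero v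
  rw [map_add, map_smul, this, smul_zero, add_zero]
  exact Submodule.orthogonalProjectionOnto_mem_subspace_eq_self y

theorem decomp (v : E) (x : E) : ∃ (y : Hp v) (s : ℝ), x = y + s • v := by
  rcases eq_or_ne v 0 with rfl | hv
  · exact ⟨⟨x, Submodule.mem_orthogonal_singleton_iff_inner_right.2 (by simp)⟩, 0, by simp⟩
  · refine ⟨⟨x - (inner ℝ v x / inner ℝ v v) • v,
      Submodule.mem_orthogonal_singleton_iff_inner_right.2 ?_⟩, inner ℝ v x / inner ℝ v v, by simp⟩
    rw [inner_sub_right, inner_smul_right, div_mul_cancel₀ _ (inner_self_ne_zero.2 hv), sub_self]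

theorem dec_ext {v : E} {A B : Set E} (h : ∀ (y : Hp v) (s : ℝ), (y : E) + s • v ∈ A ↔
    (y : E) + s • v ∈ B) : A = B := by
  ext x
  obtain ⟨y, s, rfl⟩ := decomp v x
  exact h y s

theorem dec_inj {v : E} (hv : v ≠ 0) {y y' : Hp v} {s s' : ℝ}
    (h : (y : E) + s • v = y' + s' • v) : y = y' ∧ s = s' := by
  have h1 : y = y' := by rw [← pr_add y s, h, pr_add]
  subst h1
  exact ⟨rfl, smul_left_injective ℝ hv (add_left_cancel h)⟩

/-- affine functions -/
def aff {F : Type*} [NormedAddCommGroup F] [InnerProductSpace ℝ F] (a : F) (c : ℝ) (y : F) : ℝ :=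
  inner ℝ a y + c

/-- the region between two graphs -/
def Reg (v : E) (F : Set (Hp v)) (g f : Hp v → ℝ) : Set E :=
  {x | ∃ y ∈ F, ∃ s, g y ≤ s ∧ s ≤ f y ∧ x = (y : E) + s • v}

theorem mem_Reg {v : E} (hv : v ≠ 0) {F : Set (Hp v)} {g f : Hp v → ℝ} {y : Hp v} {s : ℝ} :
    (y : E) + s • v ∈ Reg v F g f ↔ y ∈ F ∧ g y ≤ s ∧ s ≤ f y := by
  constructor
  · rintro ⟨y', hy', s', h1, h2, h⟩
    obtain ⟨rfl, rfl⟩ := dec_inj hv h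
    exact ⟨hy', h1, h2⟩
  · rintro ⟨h1, h2, h3⟩
    exact ⟨y, h1, s, h2, h3, rfl⟩

theorem isBody_Reg {v : E} {F : Set (Hp v)} (hF : IsBody F) {a b : Hp v} {c d : ℝ}
    (h : ∀ y ∈ F, aff a c y ≤ aff b d y) : IsBody (Reg v F (aff a c) (aff b d)) := by
  refine ⟨?_, ?_, ?_⟩
  · rintro _ ⟨y, hy, s, h1, h2, rfl⟩ _ ⟨y', hy', s', h1', h2', rfl⟩ α β hα hβ hαβ
    refine ⟨α • y + β • y', hF.1 hy hy' hα hβ hαβ, α * s + β * s', ?_, ?_, ?_⟩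
    · simp only [aff, inner_add_right, inner_smul_right] at *
      have := mul_le_mul_of_nonneg_left h1 hα
      have := mul_le_mul_of_nonneg_left h1' hβ
      have e : c = α * c + β * c := by rw [← add_mul, hαβ, one_mul]
      linarith
    · simp only [aff, inner_add_right, inner_smul_right] at *
      have := mul_le_mul_of_nonneg_left h2 hα
      have := mul_le_mul_of_nonneg_left h2' hβ
      have e : d = α * d + β * d := by rw [← add_mul, hαβ, one_mul]
      linarith
    · simp only [Submodule.coe_add, Submodule.coe_smul]
      module
  · have : Reg v F (aff a c) (aff b d) = (fun p : Hp v × ℝ =>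
        (p.1 : E) + (aff a c p.1 + p.2 * (aff b d p.1 - aff a c p.1)) • v) '' (F ×ˢ Icc 0 1) := by
      ext x
      constructor
      · rintro ⟨y, hy, s, h1, h2, rfl⟩
        rcases (h y hy).eq_or_lt with he | hlt
        · refine ⟨(y, 0), ⟨hy, by simp⟩, ?_⟩
          have : s = aff a c y := le_antisymm (he ▸ h2) h1
          simp [this]
        · refine ⟨(y, (s - aff a c y) / (aff b d y - aff a c y)), ⟨hy, ?_, ?_⟩, ?_⟩
          · exact div_nonneg (by linarith) (by linarith)
          · exact (div_le_one (by linarith)).2 (by linarith)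
          · simp only
            rw [div_mul_cancel₀ _ (by linarith)]
            simp
      · rintro ⟨⟨y, θ⟩, ⟨hy, h0, h1⟩, rfl⟩
        have := sub_nonneg.2 (h y hy)
        simp only at hy h0 h1
        refine ⟨y, hy, _, ?_, ?_, rfl⟩
        · nlinarith
        · simp only
          nlinarith
    rw [this]
    refine (hF.2.1.prod isCompact_Icc).image ?_
    unfold aff
    fun_prop
  · obtain ⟨y, hy⟩ := hF.2.2
    exact ⟨_, y, hy, _, le_rfl, h y hy, rfl⟩

/-- normal vector of graphs -/
def nrm (v : E) (a : Hp v) : E := (inner ℝ v v)⁻¹ • v - a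

theorem inner_nrm {v : E} (hv : v ≠ 0) (a y : Hp v) (s : ℝ) :
    inner ℝ (nrm v a) ((y : E) + s • v) = s - inner ℝ a y := by
  have : (inner ℝ v v : ℝ) ≠ 0 := inner_self_ne_zero.2 hv
  simp only [nrm, inner_sub_left, inner_add_right, real_inner_smul_left, inner_smul_right,
    inner_Hp, inner_Hp', Submodule.coe_inner]
  field_simp
  ring

theorem nrm_ne {v : E} (hv : v ≠ 0) (a : Hp v) : nrm v a ≠ 0 := by
  intro h
  have := inner_nrm hv a 0 1
  rw [h] at this
  simp at this

theorem SV.reg_add {m : Set E → ℂ} (hm : SV m) {v : E} (hv : v ≠ 0) {F : Set (Hp v)} (hF : IsBody F)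
    {a b e : Hp v} {c d k : ℝ} (h1 : ∀ y ∈ F, aff a c y ≤ aff e k y)
    (h2 : ∀ y ∈ F, aff e k y ≤ aff b d y) :
    m (Reg v F (aff a c) (aff b d)) = m (Reg v F (aff a c) (aff e k)) +
      m (Reg v F (aff e k) (aff b d)) := by
  have hb := isBody_Reg hF (fun y hy => (h1 y hy).trans (h2 y hy))
  rw [hm.cut hb.1 hb.2.1 (nrm_ne hv e) k]
  congr 2
  · refine dec_ext (v := v) fun y s => ?_
    rw [mem_inter_iff, mem_Reg hv, mem_Reg hv, mem_setOf_eq, inner_nrm hv]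
    constructor
    · rintro ⟨⟨x1, x2, x3⟩, x4⟩
      exact ⟨x1, x2, by unfold aff; linarith⟩
    · rintro ⟨x1, x2, x3⟩
      refine ⟨⟨x1, x2, x3.trans (h2 y x1)⟩, by unfold aff at x3; linarith⟩
  · refine dec_ext (v := v) fun y s => ?_
    rw [mem_inter_iff, mem_Reg hv, mem_Reg hv, mem_setOf_eq, inner_nrm hv]
    constructor
    · rintro ⟨⟨x1, x2, x3⟩, x4⟩
      exact ⟨x1, by unfold aff; linarith, x3⟩
    · rintro ⟨x1, x2, x3⟩
      refine ⟨⟨x1, (h1 y x1).trans x2, x3⟩, by unfold aff at x2; linarith⟩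

theorem Reg_shift {v : E} (hv : v ≠ 0) {F : Set (Hp v)} {a b : Hp v} (c d k : ℝ) :
    Reg v F (aff a (c + k)) (aff b (d + k)) = {k • v} + Reg v F (aff a c) (aff b d) := by
  refine dec_ext (v := v) fun y s => ?_
  rw [mem_singleton_add, mem_Reg hv]
  constructor
  · rintro ⟨h1, h2, h3⟩
    refine ⟨_, (mem_Reg hv (y := y) (s := s - k)).2 ⟨h1, ?_, ?_⟩, by module⟩
    · unfold aff at *; linarith
    · unfold aff at *; linarith
  · rintro ⟨_, ⟨y', h1, s', h2, h3, rfl⟩, h⟩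
    have e : (y' : E) + (s' + k) • v = y + s • v := by rw [← h]; module
    obtain ⟨rfl, rfl⟩ := dec_inj hv e
    refine ⟨h1, ?_, ?_⟩
    · unfold aff at *; linarith
    · unfold aff at *; linarith

theorem SV.reg_shift {m : Set E → ℂ} (hm : SV m) {v : E} (hv : v ≠ 0) {F : Set (Hp v)}
    (hF : IsBody F) {a b : Hp v} {c d : ℝ} (h : ∀ y ∈ F, aff a c y ≤ aff b d y) (k : ℝ) :
    m (Reg v F (aff a (c + k)) (aff b (d + k))) = m (Reg v F (aff a c) (aff b d)) := by
  rw [Reg_shift hv, hm.trans _ _ (isBody_Reg hF h)]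

theorem exists_shift {G : Type*} [NormedAddCommGroup G] [InnerProductSpace ℝ G]
    {F : Set G} (hF : IsCompact F) (a : G) : ∃ C, ∀ y ∈ F, 0 ≤ aff a C y := by
  obtain ⟨R, hR⟩ := hF.isBounded.subset_closedBall (0 : G)
  refine ⟨‖a‖ * R, fun y hy => ?_⟩
  have h1 := hR hy
  rw [mem_closedBall_zero_iff] at h1
  have h2 := abs_le.1 (abs_real_inner_le_norm a y)
  have h3 := mul_le_mul_of_nonneg_left h1 (norm_nonneg a)
  unfold aff
  linarith

theorem SV.reg_prism {m : Set E → ℂ} (hm : SV m) {v : E} (hv : v ≠ 0) {F : Set (Hp v)}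
    (hF : IsBody F) (a : Hp v) (c : ℝ) {d : ℝ} (hd : 0 ≤ d) :
    m (Reg v F (aff a c) (aff a (c + d))) = m (Reg v F (aff 0 0) (aff 0 d)) := by
  obtain ⟨C, hC⟩ := exists_shift hF.2.1 a
  have e1 := hm.reg_shift hv hF (a := a) (b := a) (c := c) (d := c + d)
    (fun y _ => by unfold aff; linarith) (C - c)
  rw [show c + (C - c) = C by ring, show c + d + (C - c) = C + d by ring] at e1
  have h0 : ∀ y ∈ F, aff 0 0 y ≤ aff a C y := fun y hy => by
    have := hC y hy; unfold aff at *; simpa using this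
  have e2 := hm.reg_add hv hF (a := 0) (c := 0) (b := a) (d := C + d) (e := a) (k := C) h0
    (fun y _ => by unfold aff; linarith)
  have e3 := hm.reg_add hv hF (a := 0) (c := 0) (b := a) (d := C + d) (e := 0) (k := d)
    (fun y _ => by unfold aff; linarith) (fun y hy => by
      have := h0 y hy; unfold aff at *; linarith)
  have e4 := hm.reg_shift hv hF h0 d
  rw [zero_add] at e4
  rw [e2, e4] at e3
  rw [← e1]
  linear_combination e3

theorem HClose_Reg {v : E} (hv : v ≠ 0) {F F' : Set (Hp v)} {δ : ℝ} (h : HClose δ F F') {a : Hp v}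
    {C : ℝ} (h1 : ∀ y ∈ F, 0 ≤ aff a C y) (h2 : ∀ y ∈ F', 0 ≤ aff a C y) :
    HClose (δ + ‖a‖ * δ * ‖v‖) (Reg v F (aff 0 0) (aff a C)) (Reg v F' (aff 0 0) (aff a C)) := by
  have key : ∀ F F' : Set (Hp v), HClose δ F F' → (∀ y ∈ F', 0 ≤ aff a C y) →
      ∀ x ∈ Reg v F (aff 0 0) (aff a C), ∃ x' ∈ Reg v F' (aff 0 0) (aff a C),
      dist x x' ≤ δ + ‖a‖ * δ * ‖v‖ := by
    rintro F F' h h2 _ ⟨y, hy, s, hs0, hs1, rfl⟩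
    obtain ⟨y', hy', hd⟩ := h.1 y hy
    have hs0 : 0 ≤ s := by simpa [aff] using hs0
    refine ⟨_, ⟨y', hy', min s (aff a C y'), ?_, min_le_right _ _, rfl⟩, ?_⟩
    · simpa [aff] using ⟨hs0, h2 y' hy'⟩
    · have h3 : |s - min s (aff a C y')| ≤ ‖a‖ * δ := by
        have h4 := abs_real_inner_le_norm a (y - y')
        rw [← dist_eq_norm, inner_sub_right] at h4
        have h5 := (abs_le.1 (h4.trans (mul_le_mul_of_nonneg_left hd (norm_nonneg a)))).2
        have h6 : 0 ≤ ‖a‖ * δ := mul_nonneg (norm_nonneg _) (dist_nonneg.trans hd)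
        rcases min_cases s (aff a C y') with ⟨h, h'⟩ | ⟨h, h'⟩
        · rw [h, sub_self, abs_zero]; exact h6
        · rw [h, abs_of_nonneg (by linarith)]
          unfold aff at *
          linarith
      calc dist ((y : E) + s • v) (y' + min s (aff a C y') • v)
          ≤ dist (y : E) y' + dist (s • v) (min s (aff a C y') • v) := dist_add_add_le _ _ _ _
        _ ≤ δ + ‖a‖ * δ * ‖v‖ := by
          gcongr
          · exact hd
          · rw [dist_eq_norm, ← sub_smul, norm_smul, Real.norm_eq_abs]
            gcongr
  refine ⟨key F F' h h2, fun y hy => ?_⟩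
  obtain ⟨x, hx, hd⟩ := key F' F h.symm h1 y hy
  exact ⟨x, hx, by rwa [dist_comm]⟩

theorem SV.eq_zero_of_reg {m : Set E → ℂ} (hm : SV m) {v : E} (hv : v ≠ 0)
    (h : ∀ (F : Set (Hp v)) (a : Hp v) (c : ℝ), IsBody F → (∀ y ∈ F, 0 ≤ aff a c y) →
      m (Reg v F (aff 0 0) (aff a c)) = 0) {K : Set E} (hK : IsBody K) : m K = 0 := by
  have h' : ∀ (F : Set (Hp v)) (a b : Hp v) (c d : ℝ), IsBody F →
      (∀ y ∈ F, aff a c y ≤ aff b d y) → m (Reg v F (aff a c) (aff b d)) = 0 := by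
    intro F a b c d hF hab
    obtain ⟨C, hC⟩ := exists_shift hF.2.1 a
    have e1 := hm.reg_shift hv hF hab (C - c)
    rw [show c + (C - c) = C by ring] at e1
    have hab' : ∀ y ∈ F, aff a C y ≤ aff b (d + (C - c)) y := fun y hy => by
      have := hab y hy
      unfold aff at *; linarith
    have e2 := hm.reg_add hv hF (a := 0) (c := 0) (e := a) (k := C) (b := b) (d := d + (C - c))
      (fun y hy => by have := hC y hy; unfold aff at *; simpa using this) hab'
    rw [h F a C hF hC, h F b _ hF (fun y hy => (hC y hy).trans (hab' y hy))] at e2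
    rw [← e1]
    linear_combination -e2
  refine hm.reduce_vert hv (fun p q l hp hq hl hb => ?_) hK
  set P := {x | inner ℝ p.1 x ≤ p.2} ∩ HPoly (q :: l) with hP
  have hinner : ∀ (u : E) (y : Hp v) (s : ℝ), inner ℝ u ((y : E) + s • v) =
      inner ℝ (pr v u) y + s * inner ℝ u v := by
    intro u y s
    obtain ⟨z, k, rfl⟩ := decomp v u
    rw [pr_add, inner_add_left, inner_add_right, inner_add_right]
    simp only [real_inner_smul_left, inner_smul_right, inner_Hp, inner_Hp', inner_add_left,
      Submodule.coe_inner]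
    ring
  have hmem : ∀ (y : Hp v) (s : ℝ), (y : E) + s • v ∈ P ↔
      ((∀ r ∈ l, inner ℝ (pr v r.1) y ≤ r.2) ∧ aff (pr v q.1) (-q.2) y ≤ s ∧
        s ≤ aff (-pr v p.1) p.2 y) := by
    intro y s
    rw [hP, poly_cons]
    simp only [mem_inter_iff, mem_setOf_eq, hinner, HPoly, hp, hq, aff, inner_neg_left]
    constructor
    · rintro ⟨h1, h2, h3⟩
      refine ⟨fun r hr => ?_, by linarith, by linarith⟩
      have := h3 r hr
      rw [hl r hr] at this
      linarith
    · rintro ⟨h1, h2, h3⟩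
      refine ⟨by linarith, by linarith, fun r hr => ?_⟩
      rw [hl r hr]
      linarith [h1 r hr]
  have hF : IsBody (pr v '' P) :=
    ⟨hb.1.linear_image (pr v).toLinearMap, hb.2.1.image (pr v).continuous, hb.2.2.image _⟩
  have hFm : ∀ y : Hp v, y ∈ pr v '' P ↔ ∃ s : ℝ, (y : E) + s • v ∈ P := by
    intro y
    constructor
    · rintro ⟨x, hx, rfl⟩
      obtain ⟨z, k, rfl⟩ := decomp v x
      exact ⟨k, by rwa [pr_add]⟩
    · rintro ⟨s, hs⟩
      exact ⟨_, hs, pr_add _ _⟩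
  have hPR : P = Reg v (pr v '' P) (aff (pr v q.1) (-q.2)) (aff (-pr v p.1) p.2) := by
    refine dec_ext (v := v) fun y s => ?_
    rw [mem_Reg hv, hFm]
    constructor
    · intro h
      exact ⟨⟨s, h⟩, ((hmem y s).1 h).2⟩
    · rintro ⟨⟨s', hs'⟩, h2⟩
      exact (hmem y s).2 ⟨((hmem y s').1 hs').1, h2⟩
  rw [hPR]
  refine h' _ _ _ _ _ hF ?_
  intro y hy
  obtain ⟨s, hs⟩ := (hFm y).1 hy
  exact ((hmem y s).1 hs).2.1.trans ((hmem y s).1 hs).2.2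

end Regions


section Functionals

variable {E : Type*} [NormedAddCommGroup E] [InnerProductSpace ℝ E] [FiniteDimensional ℝ E]

theorem linear_of_add {q : ℝ → ℂ} (hadd : ∀ a b, 0 ≤ a → 0 ≤ b → q (a + b) = q a + q b)
    (hc : ContinuousOn q (Ici 0)) {t : ℝ} (ht : 0 ≤ t) : q t = t * q 1 := by
  have q0 : q 0 = 0 := by simpa using hadd 0 0 le_rfl le_rfl
  let Q : ℝ →+ ℂ := AddMonoidHom.mk' (fun x => q (max x 0) - q (max (-x) 0)) (by
    intro a b
    have h1 := hadd (max (a + b) 0) (max (-a) 0 + max (-b) 0) (by positivity) (by positivity)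
    have h2 := hadd (max (-(a + b)) 0) (max a 0 + max b 0) (by positivity) (by positivity)
    have h3 := hadd (max (-a) 0) (max (-b) 0) (by positivity) (by positivity)
    have h4 := hadd (max a 0) (max b 0) (by positivity) (by positivity)
    have e : ∀ x : ℝ, max x 0 = x + max (-x) 0 := by
      intro x
      rcases le_total 0 x with h | h
      · rw [max_eq_left h, max_eq_right (by linarith)]; simp
      · rw [max_eq_right h, max_eq_left (by linarith)]; simp
    have h5 : max (a + b) 0 + (max (-a) 0 + max (-b) 0) = max (-(a + b)) 0 + (max a 0 + max b 0) := by
      rw [e a, e b, e (a + b)]; ring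
    rw [h5, h2] at h1
    linear_combination -h1 - h3 + h4)
  have hQ : Continuous Q := by
    have h1 : Continuous (fun x : ℝ => q (max x 0)) :=
      hc.comp_continuous (by fun_prop) (fun x => mem_Ici.2 (le_max_right _ _))
    exact h1.sub (h1.comp continuous_neg)
  have h := map_real_smul Q hQ t 1
  have e : ∀ x : ℝ, 0 ≤ x → Q x = q x := by
    intro x hx
    change q (max x 0) - q (max (-x) 0) = q x
    rw [max_eq_left hx, max_eq_right (by linarith), q0, sub_zero]
  rw [smul_eq_mul, mul_one, e t ht, e 1 zero_le_one] at h
  rw [h, Complex.real_smul]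

theorem SV.prism_lin {m : Set E → ℂ} (hm : SV m) {v : E} (hv : v ≠ 0) {F : Set (Hp v)}
    (hF : IsBody F) {d : ℝ} (hd : 0 ≤ d) :
    m (Reg v F (aff 0 0) (aff 0 d)) = d * m (Reg v F (aff 0 0) (aff 0 1)) := by
  have hb : ∀ d, 0 ≤ d → IsBody (Reg v F (aff 0 0) (aff 0 d)) := fun d hd =>
    isBody_Reg hF (fun y _ => by unfold aff; linarith)
  refine linear_of_add (q := fun d => m (Reg v F (aff 0 0) (aff 0 d))) ?_ ?_ hd
  · intro a b ha hb
    have e1 := hm.reg_add hv hF (a := 0) (c := 0) (e := 0) (k := a) (b := 0) (d := a + b)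
      (fun y _ => by unfold aff; linarith) (fun y _ => by unfold aff; linarith)
    rw [hm.reg_prism hv hF 0 a hb] at e1
    exact e1
  · have hvp : 0 < ‖v‖ := norm_pos_iff.2 hv
    rw [Metric.continuousOn_iff]
    intro b hb' ε hε
    obtain ⟨δ, hδ, h⟩ := hm.cont _ (hb b hb') ε hε
    refine ⟨δ / ‖v‖, by positivity, fun a ha hab => ?_⟩
    rw [dist_eq_norm]
    refine h _ (hb a ha) ?_
    have key : ∀ a b : ℝ, 0 ≤ a → 0 ≤ b → dist a b < δ / ‖v‖ →
        ∀ x ∈ Reg v F (aff 0 0) (aff 0 b), ∃ y ∈ Reg v F (aff 0 0) (aff 0 a), dist x y ≤ δ := by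
      rintro a b ha hb hab _ ⟨y, hy, s, h1, h2, rfl⟩
      simp only [aff, inner_zero_left, zero_add] at h1 h2
      refine ⟨_, ⟨y, hy, min s a, ?_, ?_, rfl⟩, ?_⟩
      · simp [aff, h1, ha]
      · simp [aff]
      · rw [dist_add_left, dist_eq_norm, ← sub_smul, norm_smul, Real.norm_eq_abs]
        have : |s - min s a| ≤ δ / ‖v‖ := by
          rw [Real.dist_eq] at hab
          have := (abs_lt.1 hab).1
          rcases min_cases s a with ⟨h, h'⟩ | ⟨h, h'⟩
          · rw [h, sub_self, abs_zero]; positivity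
          · rw [h, abs_of_nonneg (by linarith)]; linarith
        rwa [le_div_iff₀ hvp] at this
    refine ⟨key a b ha hb' hab, fun y hy => ?_⟩
    obtain ⟨x, hx, h⟩ := key b a hb' ha (by rwa [dist_comm]) y hy
    exact ⟨x, hx, by rwa [dist_comm]⟩

/-- vanishing on prisms in direction `v` -/
def Good (m : Set E → ℂ) (v : E) : Prop :=
  ∀ F : Set (Hp v), IsBody F → m (Reg v F (aff 0 0) (aff 0 1)) = 0

theorem Good.reg {m : Set E → ℂ} {v : E} (hg : Good m v) (hm : SV m) (hv : v ≠ 0) {F : Set (Hp v)}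
    (hF : IsBody F) (a : Hp v) (c : ℝ) {d : ℝ} (hd : 0 ≤ d) :
    m (Reg v F (aff a c) (aff a (c + d))) = 0 := by
  rw [hm.reg_prism hv hF a c hd, hm.prism_lin hv hF hd, hg F hF, mul_zero]

theorem inner_decomp {v : E} (u : E) (y : Hp v) (s : ℝ) : inner ℝ u ((y : E) + s • v) =
      inner ℝ (pr v u) y + s * inner ℝ u v := by
  obtain ⟨z, k, rfl⟩ := decomp v u
  rw [pr_add, inner_add_left, inner_add_right, inner_add_right]
  simp only [real_inner_smul_left, inner_smul_right, inner_Hp, inner_Hp', inner_add_left,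
    Submodule.coe_inner]
  ring

theorem Good.oblique {m : Set E → ℂ} {v : E} (hg : Good m v) (hm : SV m) (hv : v ≠ 0) {A : Set E}
    (hA : IsBody A) {u : E} (hu : u ≠ 0) {c : ℝ} (hc : ∀ x ∈ A, inner ℝ u x = c) :
    m (A + sg v) = 0 := by
  by_cases huv : inner ℝ u v = 0
  · refine hm.simple _ u c (hA.add (isBody_sg v)) hu ?_
    rintro _ ⟨x, hx, y, hy, rfl⟩
    obtain ⟨s, -, -, rfl⟩ := mem_sg.1 hy
    simp only [inner_add_right, inner_smul_right, hc x hx, huv]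
    simp
  · have hF : IsBody (pr v '' A) :=
      ⟨hA.1.linear_image (pr v).toLinearMap, hA.2.1.image (pr v).continuous, hA.2.2.image _⟩
    have key : A + sg v = Reg v (pr v '' A) (aff (-(inner ℝ u v)⁻¹ • pr v u) (c / inner ℝ u v))
        (aff (-(inner ℝ u v)⁻¹ • pr v u) (c / inner ℝ u v + 1)) := by
      have hs : ∀ (y : Hp v) (s : ℝ), (y : E) + s • v ∈ A → 
          s = aff (-(inner ℝ u v)⁻¹ • pr v u) (c / inner ℝ u v) y := by
        intro y s h
        have h1 := hc _ h
        rw [inner_decomp] at h1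
        simp only [aff, real_inner_smul_left, neg_mul]
        field_simp
        linarith
      refine dec_ext (v := v) fun y s => ?_
      rw [mem_Reg hv]
      constructor
      · rintro ⟨x, hx, z, hz, h⟩
        obtain ⟨θ, h0, h1, rfl⟩ := mem_sg.1 hz
        obtain ⟨y', s', rfl⟩ := decomp v x
        have e : (y' : E) + (s' + θ) • v = y + s • v := by rw [← h]; module
        obtain ⟨rfl, rfl⟩ := dec_inj hv e
        have h2 := hs _ _ hx
        refine ⟨⟨_, hx, pr_add _ _⟩, ?_, ?_⟩
        · rw [← h2]; linarith
        · have : aff (-(inner ℝ u v)⁻¹ • pr v u) (c / inner ℝ u v + 1) y' = s' + 1 := by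
            rw [h2]; unfold aff; ring
          rw [this]; linarith
      · rintro ⟨⟨x, hx, rfl⟩, h1, h2⟩
        obtain ⟨y', s', rfl⟩ := decomp v x
        rw [pr_add] at h1 h2 ⊢
        have h3 := hs _ _ hx
        have : aff (-(inner ℝ u v)⁻¹ • pr v u) (c / inner ℝ u v + 1) y' = s' + 1 := by
            rw [h3]; unfold aff; ring
        rw [← h3] at h1
        rw [this] at h2
        exact ⟨_, hx, (s - s') • v, mem_sg.2 ⟨s - s', by linarith, by linarith, rfl⟩, by module⟩
    rw [key]
    exact hg.reg hm hv hF _ _ zero_le_one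

theorem SV_of_reg {m : Set E → ℂ} (hm : SV m) {v : E} (hv : v ≠ 0) (a : Hp v)
    (T : Set (Hp v) → ℂ) (h0 : T ∅ = 0) (htr : ∀ x K, IsBody K → T ({x} + K) = T K)
    (hT : ∀ R, ∃ C, ∀ F, IsBody F → F ⊆ closedBall 0 R →
      (∀ y ∈ F, 0 ≤ aff a C y) ∧ T F = m (Reg v F (aff 0 0) (aff a C))) : SV T where
  empty := h0
  val K L hK hL hU hI := by
    obtain ⟨R, hR⟩ := hU.2.1.isBounded.subset_closedBall 0
    obtain ⟨C, hC⟩ := hT R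
    have b : ∀ F, IsBody F → F ⊆ closedBall 0 R → IsBody (Reg v F (aff 0 0) (aff a C)) :=
      fun F hF hs => isBody_Reg hF (fun y hy => by simpa [aff] using (hC F hF hs).1 y hy)
    have sK : K ⊆ closedBall 0 R := subset_union_left.trans hR
    have sL : L ⊆ closedBall 0 R := subset_union_right.trans hR
    have sI : K ∩ L ⊆ closedBall 0 R := inter_subset_left.trans sK
    have e1 : Reg v (K ∪ L) (aff 0 0) (aff a C) =
        Reg v K (aff 0 0) (aff a C) ∪ Reg v L (aff 0 0) (aff a C) := by
      refine dec_ext (v := v) fun y s => ?_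
      simp only [mem_union, mem_Reg hv]
      tauto
    have e2 : Reg v (K ∩ L) (aff 0 0) (aff a C) =
        Reg v K (aff 0 0) (aff a C) ∩ Reg v L (aff 0 0) (aff a C) := by
      refine dec_ext (v := v) fun y s => ?_
      simp only [mem_inter_iff, mem_Reg hv]
      tauto
    rw [(hC _ hU hR).2, (hC _ hK sK).2, (hC _ hL sL).2, (hC _ hI sI).2, e1, e2]
    exact hm.val _ _ (b K hK sK) (b L hL sL) (e1 ▸ b _ hU hR) (e2 ▸ b _ hI sI)
  cont K hK ε hε := by
    obtain ⟨R, hR⟩ := hK.2.1.isBounded.subset_closedBall 0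
    obtain ⟨C, hC⟩ := hT (R + 1)
    have b : ∀ F, IsBody F → F ⊆ closedBall 0 (R + 1) → IsBody (Reg v F (aff 0 0) (aff a C)) :=
      fun F hF hs => isBody_Reg hF (fun y hy => by simpa [aff] using (hC F hF hs).1 y hy)
    have sK : K ⊆ closedBall 0 (R + 1) := hR.trans (closedBall_subset_closedBall (by linarith))
    obtain ⟨δ, hδ, h⟩ := hm.cont _ (b K hK sK) ε hε
    have hpos : 0 < 1 + ‖a‖ * ‖v‖ := by positivity
    refine ⟨min 1 (δ / (1 + ‖a‖ * ‖v‖)), by positivity, fun L hL hKL => ?_⟩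
    have sL : L ⊆ closedBall 0 (R + 1) := by
      intro y hy
      obtain ⟨x, hx, hd⟩ := hKL.2 y hy
      have h1 := hR hx
      rw [mem_closedBall] at h1 ⊢
      have h2 := dist_triangle y x 0
      rw [dist_comm y x] at h2
      have h3 := hd.trans (min_le_left _ _)
      linarith
    rw [(hC _ hK sK).2, (hC _ hL sL).2]
    refine h _ (b L hL sL) ((HClose_Reg hv hKL (hC _ hK sK).1 (hC _ hL sL).1).mono ?_)
    have h4 := min_le_right 1 (δ / (1 + ‖a‖ * ‖v‖))
    rw [le_div_iff₀ hpos] at h4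
    linarith
  trans := htr
  simple K u c hK hu h := by
    obtain ⟨R, hR⟩ := hK.2.1.isBounded.subset_closedBall 0
    obtain ⟨C, hC⟩ := hT R
    rw [(hC K hK hR).2]
    refine hm.simple _ (u : E) c
      (isBody_Reg hK (fun y hy => by simpa [aff] using (hC K hK hR).1 y hy)) (by simpa using hu) ?_
    rintro _ ⟨y, hy, s, -, -, rfl⟩
    rw [inner_add_right, inner_smul_right, inner_Hp', mul_zero, add_zero]
    exact h y hy

theorem Reg_empty {v : E} (g f : Hp v → ℝ) : Reg v ∅ g f = ∅ := by
  ext x; simp [Reg]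

theorem Reg_trans {v : E} (hv : v ≠ 0) (x : Hp v) (F : Set (Hp v)) (a : Hp v) (C : ℝ) :
    Reg v ({x} + F) (aff 0 0) (aff a C) =
      {(x : E)} + Reg v F (aff 0 0) (aff a (C + inner ℝ a x)) := by
  refine dec_ext (v := v) fun y s => ?_
  rw [mem_Reg hv, mem_singleton_add, mem_singleton_add]
  constructor
  · rintro ⟨⟨k, hk, rfl⟩, h1, h2⟩
    refine ⟨_, (mem_Reg hv (y := k) (s := s)).2 ⟨hk, ?_, ?_⟩, ?_⟩
    · simpa [aff] using h1
    · simp only [aff, inner_add_right] at h2 ⊢; linarith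
    · rw [Submodule.coe_add]; abel
  · rintro ⟨_, ⟨k, hk, s', h1, h2, rfl⟩, h⟩
    have e : ((x + k : Hp v) : E) + s' • v = y + s • v := by
      rw [← h, Submodule.coe_add]; abel
    obtain ⟨rfl, rfl⟩ := dec_inj hv e
    refine ⟨⟨k, hk, rfl⟩, ?_, ?_⟩
    · simpa [aff] using h1
    · simp only [aff, inner_add_right] at h2 ⊢; linarith

/-- prism functional -/
def T0 (m : Set E → ℂ) (v : E) (F : Set (Hp v)) : ℂ := m (Reg v F (aff 0 0) (aff 0 1))

theorem SV.T0 {m : Set E → ℂ} (hm : SV m) {v : E} (hv : v ≠ 0) : SV (T0 m v) := by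
  refine SV_of_reg hm hv 0 _ ?_ ?_ ?_
  · rw [_root_.T0, Reg_empty, hm.empty]
  · intro x K hK
    rw [_root_.T0, _root_.T0, Reg_trans hv, hm.trans]
    · simp
    · exact isBody_Reg hK (fun y _ => by simp [aff])
  · intro R
    refine ⟨1, fun F hF _ => ⟨fun y _ => by simp [aff], rfl⟩⟩

theorem neg_Reg {v : E} (hv : v ≠ 0) (F : Set (Hp v)) (a b : Hp v) (c d : ℝ) :
    Reg v (-F) (aff a c) (aff b d) = -Reg v F (aff b (-d)) (aff a (-c)) := by
  refine dec_ext (v := v) fun y s => ?_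
  have : -((y : E) + s • v) = ((-y : Hp v) : E) + (-s) • v := by
    rw [Submodule.coe_neg]; module
  rw [mem_Reg hv, Set.mem_neg, Set.mem_neg, this, mem_Reg hv]
  simp only [aff, inner_neg_right]
  constructor
  · rintro ⟨h1, h2, h3⟩; exact ⟨h1, by linarith, by linarith⟩
  · rintro ⟨h1, h2, h3⟩; exact ⟨h1, by linarith, by linarith⟩

theorem Par.T0 {m : Set E → ℂ} {σ : ℂ} (hp : Par σ m) (hm : SV m) {v : E} (hv : v ≠ 0) :
    Par σ (T0 m v) := by
  intro F hF
  have hb : IsBody (Reg v F (aff 0 (-1)) (aff 0 (-0))) :=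
    isBody_Reg hF (fun y _ => by simp [aff])
  rw [_root_.T0, _root_.T0, neg_Reg hv, hp _ hb]
  have := hm.reg_shift hv hF (a := 0) (b := 0) (c := -1) (d := -0) (fun y _ => by simp [aff]) 1
  rw [← this]
  simp

/-- sloped functional -/
def Ta (m : Set E → ℂ) (v : E) (a : Hp v) (F : Set (Hp v)) : ℂ :=
  m (Reg v F (aff 0 0) (aff a (Classical.epsilon fun C => ∀ y ∈ F, 0 ≤ aff a C y)))

theorem Good.Ta_eq {m : Set E → ℂ} {v : E} (hg : Good m v) (hm : SV m) (hv : v ≠ 0) {a : Hp v}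
    {F : Set (Hp v)} (hF : IsBody F) {C : ℝ} (hC : ∀ y ∈ F, 0 ≤ aff a C y) :
    Ta m v a F = m (Reg v F (aff 0 0) (aff a C)) := by
  have key : ∀ C C' : ℝ, (∀ y ∈ F, 0 ≤ aff a C y) → C ≤ C' →
      m (Reg v F (aff 0 0) (aff a C')) = m (Reg v F (aff 0 0) (aff a C)) := by
    intro C C' hC h
    rw [hm.reg_add hv hF (a := 0) (c := 0) (e := a) (k := C) (b := a) (d := C')
      (fun y hy => by simpa [aff] using hC y hy) (fun y _ => by unfold aff; linarith)]
    have := hg.reg hm hv hF a C (sub_nonneg.2 h)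
    rw [add_sub_cancel] at this
    rw [this, add_zero]
  have h2 : ∀ y ∈ F, 0 ≤ aff a (Classical.epsilon fun C => ∀ y ∈ F, 0 ≤ aff a C y) y :=
    Classical.epsilon_spec (p := fun C => ∀ y ∈ F, 0 ≤ aff a C y) ⟨C, hC⟩
  rw [Ta]
  rcases le_total C (Classical.epsilon fun C => ∀ y ∈ F, 0 ≤ aff a C y) with h | h
  · exact key _ _ hC h
  · exact (key _ _ h2 h).symm

theorem Good.Ta_SV {m : Set E → ℂ} {v : E} (hg : Good m v) (hm : SV m) (hv : v ≠ 0) (a : Hp v) :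
    SV (Ta m v a) := by
  refine SV_of_reg hm hv a _ ?_ ?_ ?_
  · rw [Ta, Reg_empty, hm.empty]
  · intro x K hK
    have hb := (isBody_singleton x).add hK
    obtain ⟨C, hC⟩ := exists_shift hb.2.1 a
    have hC' : ∀ y ∈ K, 0 ≤ aff a (C + inner ℝ a x) y := by
      intro y hy
      have := hC (x + y) (mem_singleton_add.2 ⟨y, hy, rfl⟩)
      simp only [aff, inner_add_right] at this ⊢
      linarith
    rw [hg.Ta_eq hm hv hb hC, Reg_trans hv, hm.trans, hg.Ta_eq hm hv hK hC']
    exact isBody_Reg hK (fun y hy => by simpa [aff] using hC' y hy)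
  · intro R
    refine ⟨‖a‖ * R, fun F hF hR => ?_⟩
    have : ∀ y ∈ F, 0 ≤ aff a (‖a‖ * R) y := by
      intro y hy
      have h1 := hR hy
      rw [mem_closedBall_zero_iff] at h1
      have h2 := abs_le.1 (abs_real_inner_le_norm a y)
      have h3 := mul_le_mul_of_nonneg_left h1 (norm_nonneg a)
      unfold aff
      linarith
    exact ⟨this, hg.Ta_eq hm hv hF this⟩

theorem Good.Ta_Par {m : Set E → ℂ} {v : E} (hg : Good m v) (hm : SV m) (hv : v ≠ 0) (a : Hp v)
    (hp : Par (-1) m) : Par 1 (Ta m v a) := by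
  intro F hF
  obtain ⟨C, hC⟩ := exists_shift hF.2.1 a
  obtain ⟨C', hC'⟩ := exists_shift hF.neg.2.1 a
  have c1 : ∀ y ∈ F, 0 ≤ aff a (max C C') y := fun y hy => by
    have := hC y hy
    unfold aff at *
    linarith [le_max_left C C']
  have c2 : ∀ y ∈ -F, 0 ≤ aff a (max C C') y := fun y hy => by
    have := hC' y hy
    unfold aff at *
    linarith [le_max_right C C']
  generalize max C C' = D at *
  have c3 : ∀ y ∈ F, aff a (-D) y ≤ 0 := by
    intro y hy
    have := c2 (-y) (by simpa using hy)
    simp only [aff, inner_neg_right] at *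
    linarith
  have hb : IsBody (Reg v F (aff a (-D)) (aff 0 (-0))) :=
    isBody_Reg hF (fun y hy => by simpa [aff] using c3 y hy)
  rw [hg.Ta_eq hm hv hF c1, hg.Ta_eq hm hv hF.neg c2, neg_Reg hv, hp _ hb, neg_zero]
  have h1 := hm.reg_add hv hF (a := a) (c := -D) (e := 0) (k := 0) (b := a) (d := D)
    (fun y hy => by simpa [aff] using c3 y hy) (fun y hy => by simpa [aff] using c1 y hy)
  obtain ⟨y, hy⟩ := hF.2.2
  have h2 := hg.reg hm hv hF a (-D) (d := 2 * D) (by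
    have := c1 y hy
    have := c3 y hy
    unfold aff at *
    linarith)
  rw [show -D + 2 * D = D by ring, h1] at h2
  linear_combination -h2

theorem smul_Reg {v : E} (hv : v ≠ 0) {t : ℝ} (ht : 0 < t) (F : Set (Hp v)) (a : Hp v) (c : ℝ) :
    t • Reg v F (aff 0 0) (aff a c) = Reg v (t • F) (aff 0 0) (aff a (t * c)) := by
  refine dec_ext (v := v) fun y s => ?_
  rw [mem_Reg hv, mem_smul_set_iff_inv_smul_mem₀ ht.ne', mem_smul_set_iff_inv_smul_mem₀ ht.ne']
  have : t⁻¹ • ((y : E) + s • v) = ((t⁻¹ • y : Hp v) : E) + (t⁻¹ * s) • v := by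
    rw [Submodule.coe_smul]; module
  rw [this, mem_Reg hv]
  simp only [aff, inner_smul_right, inner_zero_left, zero_add, mul_zero]
  refine and_congr Iff.rfl (and_congr ?_ ?_)
  · constructor
    · intro h
      have := mul_le_mul_of_nonneg_left h ht.le
      rwa [mul_zero, mul_inv_cancel_left₀ ht.ne'] at this
    · intro h; positivity
  · rw [inv_mul_le_iff₀ ht, mul_add, mul_inv_cancel_left₀ ht.ne']

theorem add_inter_of_union {K L Z : Set E} (hK : IsClosed K) (hL : IsClosed L)
    (hU : Convex ℝ (K ∪ L)) (hZ : Convex ℝ Z) : (K ∩ L) + Z = (K + Z) ∩ (L + Z) := by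
  refine subset_antisymm (subset_inter (add_subset_add_right inter_subset_left)
    (add_subset_add_right inter_subset_right)) ?_
  rintro x ⟨⟨k, hk, z, hz, rfl⟩, ⟨l, hl, z', hz', h⟩⟩
  obtain ⟨θ, h0, h1, h2⟩ := exists_inter hK hL hU hk hl
  refine ⟨_, h2, (1 - θ) • z + θ • z', hZ hz hz' (by linarith) h0 (by ring), ?_⟩
  have h : l + z' = k + z := h
  have : k + θ • (l - k) + ((1 - θ) • z + θ • z') = (1 - θ) • (k + z) + θ • (l + z') := by module
  simp only
  rw [this, h]
  module

/-- adding a segment in a good direction changes nothing -/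
theorem Good.add_sg {m : Set E → ℂ} {v : E} (hg : Good m v) (hm : SV m) (hv : v ≠ 0) {K : Set E}
    (hK : IsBody K) : m (K + sg v) = m K := by
  have hs : SV (fun K => m (K + sg v)) := by
    refine ⟨by simp [hm.empty], ?_, ?_, ?_, ?_⟩
    · intro K L hK hL hU hI
      have := hm.val _ _ (hK.add (isBody_sg v)) (hL.add (isBody_sg v))
        (by rw [← union_add]; exact hU.add (isBody_sg v))
        (by rw [← add_inter_of_union hK.isClosed hL.isClosed hU.1 (isBody_sg v).1]
            exact hI.add (isBody_sg v))
      rwa [← union_add, ← add_inter_of_union hK.isClosed hL.isClosed hU.1 (isBody_sg v).1] at this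
    · intro K hK ε hε
      obtain ⟨δ, hδ, h⟩ := hm.cont _ (hK.add (isBody_sg v)) ε hε
      exact ⟨δ, hδ, fun L hL hKL => h _ (hL.add (isBody_sg v)) (hKL.add _)⟩
    · intro x K hK
      rw [add_assoc, hm.trans _ _ (hK.add (isBody_sg v))]
    · intro K u c hK hu h
      exact hg.oblique hm hv hK hu h
  have h0 := (hs.lin hm 1 (-1)).eq_zero_of_reg hv ?_ hK
  · linear_combination h0
  · intro F a c hF hac
    have e : Reg v F (aff 0 0) (aff a c) + sg v = Reg v F (aff 0 0) (aff a (c + 1)) := by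
      refine dec_ext (v := v) fun y s => ?_
      rw [mem_Reg hv]
      constructor
      · rintro ⟨x, hx, z, hz, h⟩
        obtain ⟨θ, h0, h1, rfl⟩ := mem_sg.1 hz
        obtain ⟨y', s', rfl⟩ := decomp v x
        have e : (y' : E) + (s' + θ) • v = y + s • v := by rw [← h]; module
        obtain ⟨rfl, rfl⟩ := dec_inj hv e
        rw [mem_Reg hv] at hx
        obtain ⟨h2, h3, h4⟩ := hx
        unfold aff at *
        exact ⟨h2, by linarith, by linarith⟩
      · rintro ⟨h1, h2, h3⟩
        have h4 := hac y h1
        have h5 : 0 ≤ s := by simpa [aff] using h2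
        rcases le_total s (aff a c y) with h | h
        · exact ⟨_, (mem_Reg hv (y := y) (s := s)).2 ⟨h1, h2, h⟩, 0,
            mem_sg.2 ⟨0, by simp, by simp, by simp⟩, by simp⟩
        · refine ⟨_, (mem_Reg hv (y := y) (s := aff a c y)).2 ⟨h1, by simpa [aff] using h4, le_rfl⟩,
            (s - aff a c y) • v, mem_sg.2 ⟨_, by linarith, ?_, rfl⟩, ?_⟩
          · unfold aff at *; linarith
          · simp only; module
    simp only [e]
    rw [hm.reg_add hv hF (a := 0) (c := 0) (e := a) (k := c) (b := a) (d := c + 1)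
      (fun y hy => by simpa [aff] using hac y hy) (fun y _ => by unfold aff; linarith),
      hg.reg hm hv hF a c zero_le_one]
    ring

end Functionals


section Support

variable {E : Type*} [NormedAddCommGroup E] [InnerProductSpace ℝ E] [FiniteDimensional ℝ E]

/-- `h` is the support function of `K` -/
def IsSupp (h : E → ℝ) (K : Set E) : Prop :=
  ∀ x, (∀ y ∈ K, inner ℝ x y ≤ h x) ∧ ∃ y ∈ K, inner ℝ x y = h x

theorem exists_isSupp {K : Set E} (hK : IsBody K) : ∃ h, IsSupp h K := by
  have : ∀ x : E, ∃ y ∈ K, IsMaxOn (fun y => inner ℝ x y) K y := fun x =>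
    hK.2.1.exists_isMaxOn hK.2.2 (by fun_prop)
  choose y hy hm using this
  exact ⟨fun x => inner ℝ x (y x), fun x => ⟨fun z hz => hm x hz, y x, hy x, rfl⟩⟩

theorem IsSupp.add {h h' : E → ℝ} {K L : Set E} (hK : IsSupp h K) (hL : IsSupp h' L) :
    IsSupp (fun x => h x + h' x) (K + L) := by
  intro x
  constructor
  · rintro _ ⟨k, hk, l, hl, rfl⟩
    have h1 := (hK x).1 k hk
    have h2 := (hL x).1 l hl
    simp only [inner_add_right]
    linarith
  · obtain ⟨k, hk, h1⟩ := (hK x).2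
    obtain ⟨l, hl, h2⟩ := (hL x).2
    exact ⟨k + l, ⟨k, hk, l, hl, rfl⟩, by rw [inner_add_right, h1, h2]⟩

theorem HClose_of_isSupp {h h' : E → ℝ} {K L : Set E} (hK : IsSupp h K) (hL : IsSupp h' L)
    (bK : IsBody K) (bL : IsBody L) {ε : ℝ} (hε : 0 ≤ ε) (hh : ∀ x, |h x - h' x| ≤ ε * ‖x‖) :
    HClose ε K L := by
  have key : ∀ (h h' : E → ℝ) (K L : Set E), IsSupp h K → IsSupp h' L → IsBody L →
      (∀ x, |h x - h' x| ≤ ε * ‖x‖) → ∀ k ∈ K, ∃ l ∈ L, dist k l ≤ ε := by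
    intro h h' K L hK hL bL hh k hk
    obtain ⟨l, hl, hn⟩ := exists_norm_eq_iInf_of_complete_convex bL.2.2 bL.2.1.isComplete bL.1 k
    rw [norm_eq_iInf_iff_real_inner_le_zero bL.1 hl] at hn
    refine ⟨l, hl, ?_⟩
    have h1 := (hK (k - l)).1 k hk
    obtain ⟨l', hl', h2⟩ := (hL (k - l)).2
    have h3 := hn l' hl'
    rw [inner_sub_right] at h3
    have h4 := (abs_le.1 (hh (k - l))).2
    have h5 : ‖k - l‖ * ‖k - l‖ ≤ ε * ‖k - l‖ := by
      rw [← real_inner_self_eq_norm_mul_norm]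
      nth_rewrite 3 [← sub_zero k]
      rw [sub_zero, inner_sub_right]
      linarith
    rw [dist_eq_norm]
    rcases (norm_nonneg (k - l)).eq_or_lt with h0 | h0
    · rw [← h0]; exact hε
    · exact le_of_mul_le_mul_right h5 h0
  refine ⟨key h h' K L hK hL bL hh, fun l hl => ?_⟩
  obtain ⟨k, hk, hd⟩ := key h' h L K hL hK bK (fun x => by rw [abs_sub_comm]; exact hh x) l hl
  exact ⟨k, hk, by rwa [dist_comm]⟩

theorem eq_of_isSupp {h : E → ℝ} {K L : Set E} (hK : IsSupp h K) (hL : IsSupp h L)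
    (bK : IsBody K) (bL : IsBody L) : K = L := by
  have hc := HClose_of_isSupp hK hL bK bL le_rfl (fun x => by simp)
  refine subset_antisymm (fun x hx => ?_) (fun x hx => ?_)
  · obtain ⟨y, hy, hd⟩ := hc.1 x hx
    rwa [dist_le_zero.1 hd]
  · obtain ⟨y, hy, hd⟩ := hc.2 x hx
    rwa [← dist_le_zero.1 hd]

theorem wulff {h : E → ℝ} (hadd : ∀ x y, h (x + y) ≤ h x + h y)
    (hhom : ∀ c : ℝ, 0 < c → ∀ x, h (c • x) = c * h x) {R : ℝ} (hR : ∀ x, h x ≤ R * ‖x‖) :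
    ∃ K, IsBody K ∧ IsSupp h K := by
  have h0 : h 0 = 0 := by
    have := hhom 2 (by norm_num) 0
    rw [smul_zero] at this
    linarith
  have key : ∀ x0 : E, ∃ y : E, (∀ x, inner ℝ x y ≤ h x) ∧ inner ℝ x0 y = h x0 := by
    intro x0
    have hwd : ∀ c : ℝ, c • x0 = 0 → (RingHom.id ℝ) c • h x0 = 0 := by
      intro c hc
      rcases smul_eq_zero.1 hc with rfl | rfl
      · simp
      · simp [h0]
    obtain ⟨g, hg1, hg2⟩ := exists_extension_of_le_sublinear
      (LinearPMap.mkSpanSingleton' (σ := RingHom.id ℝ) x0 (h x0) hwd) h hhom hadd (by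
        rintro ⟨z, hz⟩
        obtain ⟨c, rfl⟩ := Submodule.mem_span_singleton.1 hz
        rw [LinearPMap.mkSpanSingleton'_apply]
        simp only [RingHom.id_apply, smul_eq_mul]
        rcases lt_trichotomy c 0 with hc | rfl | hc
        · have h1 := hhom (-c) (by linarith) x0
          have h2 := hadd (c • x0) ((-c) • x0)
          rw [← add_smul, add_neg_cancel, zero_smul, h0, h1] at h2
          linarith
        · simp [h0]
        · exact (hhom c hc x0).ge)
    refine ⟨(InnerProductSpace.toDual ℝ E).symm g.toContinuousLinearMap, fun x => ?_, ?_⟩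
    · rw [real_inner_comm]
      simpa using hg2 x
    · rw [real_inner_comm]
      have := hg1 ⟨x0, Submodule.mem_span_singleton_self x0⟩
      have h2 := this.trans (LinearPMap.mkSpanSingleton'_apply_self (σ := RingHom.id ℝ) x0 (h x0) hwd
        (Submodule.mem_span_singleton_self x0))
      simpa using h2
  refine ⟨{y | ∀ x, inner ℝ x y ≤ h x}, ⟨?_, ?_, ?_⟩, ?_⟩
  · have : {y | ∀ x, inner ℝ x y ≤ h x} = ⋂ x, {y | inner ℝ x y ≤ h x} := by ext; simp
    rw [this]
    exact convex_iInter fun x => convex_le_inner _ _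
  · refine Metric.isCompact_of_isClosed_isBounded ?_ ?_
    · have : {y | ∀ x, inner ℝ x y ≤ h x} = ⋂ x, {y | inner ℝ x y ≤ h x} := by ext; simp
      rw [this]
      exact isClosed_iInter fun x => isClosed_le_inner _ _
    · refine (isBounded_closedBall (x := (0 : E)) (r := |R|)).subset ?_
      intro y hy
      have h1 := (hy y).trans (hR y)
      rw [real_inner_self_eq_norm_mul_norm] at h1
      rw [mem_closedBall_zero_iff]
      rcases (norm_nonneg y).eq_or_lt with h2 | h2
      · rw [← h2]; positivity
      · exact (le_of_mul_le_mul_right h1 h2).trans (le_abs_self R)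
  · obtain ⟨y, hy, -⟩ := key 0
    exact ⟨y, hy⟩
  · intro x
    obtain ⟨y, hy, h1⟩ := key x
    exact ⟨fun z hz => hz x, y, hy, h1⟩

/-- support functions of bodies whose addition does not change `m` -/
def Neu (m : Set E → ℂ) (h : E → ℝ) : Prop :=
  ∃ Z, IsBody Z ∧ IsSupp h Z ∧ ∀ K, IsBody K → m (K + Z) = m K

theorem Neu.add {m : Set E → ℂ} {h h' : E → ℝ} (H : Neu m h) (H' : Neu m h') :
    Neu m (fun x => h x + h' x) := by
  obtain ⟨Z, b, s, e⟩ := H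
  obtain ⟨Z', b', s', e'⟩ := H'
  refine ⟨Z + Z', b.add b', s.add s', fun K hK => ?_⟩
  rw [← add_assoc, e' _ (hK.add b), e K hK]

theorem neu_zero (m : Set E → ℂ) : Neu m (fun _ => 0) :=
  ⟨{0}, isBody_singleton 0, fun x => by simp, fun K _ => by simp⟩

theorem neu_seg {m : Set E → ℂ} (hm : SV m) (hinv : ∀ K, IsBody K → ∀ v, m (K + sg v) = m K)
    (v : E) : Neu m (fun x => |inner ℝ x v|) := by
  refine ⟨{-v} + sg ((2 : ℝ) • v), (isBody_singleton _).add (isBody_sg _), fun x => ⟨?_, ?_⟩, ?_⟩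
  · intro y hy
    obtain ⟨k, hk, rfl⟩ := mem_singleton_add.1 hy
    obtain ⟨s, h0, h1, rfl⟩ := mem_sg.1 hk
    simp only [inner_add_right, inner_neg_right, inner_smul_right]
    have e : -inner ℝ x v + s * (2 * inner ℝ x v) = (2 * s - 1) * inner ℝ x v := by ring
    rw [e]
    refine (le_abs_self _).trans ?_
    rw [abs_mul]
    exact mul_le_of_le_one_left (abs_nonneg _) (abs_le.2 ⟨by linarith, by linarith⟩)
  · rcases le_total 0 (inner ℝ x v) with h | h
    · refine ⟨-v + (1 : ℝ) • ((2 : ℝ) • v), mem_singleton_add.2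
        ⟨_, mem_sg.2 ⟨1, by norm_num, by norm_num, rfl⟩, rfl⟩, ?_⟩
      simp only [inner_add_right, inner_neg_right, inner_smul_right, abs_of_nonneg h]
      ring
    · refine ⟨-v + (0 : ℝ) • ((2 : ℝ) • v), mem_singleton_add.2
        ⟨_, mem_sg.2 ⟨0, by norm_num, by norm_num, rfl⟩, rfl⟩, ?_⟩
      simp only [inner_add_right, inner_neg_right, inner_smul_right, abs_of_nonpos h]
      ring
  · intro K hK
    rw [← add_assoc, add_comm K, add_assoc, hm.trans _ _ (hK.add (isBody_sg _)), hinv K hK]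

theorem neu_limit {m : Set E → ℂ} (hm : SV m) {h : E → ℝ} (hadd : ∀ x y, h (x + y) ≤ h x + h y)
    (hhom : ∀ c : ℝ, 0 < c → ∀ x, h (c • x) = c * h x) {R : ℝ} (hR : ∀ x, h x ≤ R * ‖x‖)
    (happ : ∀ ε > 0, ∃ h', Neu m h' ∧ ∀ x, |h x - h' x| ≤ ε * ‖x‖) : Neu m h := by
  obtain ⟨Z, hZ, hs⟩ := wulff hadd hhom hR
  refine ⟨Z, hZ, hs, fun K hK => ?_⟩
  by_contra hne
  obtain ⟨δ, hδ, h1⟩ := hm.cont _ (hK.add hZ) ‖m (K + Z) - m K‖ (norm_pos_iff.2 (sub_ne_zero.2 hne))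
  obtain ⟨h', ⟨Z', hZ', hs', e'⟩, hh⟩ := happ δ hδ
  have hc := (HClose_of_isSupp hs hs' hZ hZ' hδ.le hh).add K
  have := h1 (K + Z') (hK.add hZ') (by rw [add_comm K, add_comm K]; exact hc)
  rw [e' K hK, norm_sub_rev] at this
  exact lt_irrefl _ this

theorem IsSupp.hom {h : E → ℝ} {K : Set E} (hK : IsSupp h K) {c : ℝ} (hc : 0 < c) (x : E) :
    h (c • x) = c * h x := by
  obtain ⟨y, hy, h1⟩ := (hK x).2
  obtain ⟨z, hz, h2⟩ := (hK (c • x)).2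
  have h3 := (hK x).1 z hz
  have h4 := (hK (c • x)).1 y hy
  rw [real_inner_smul_left] at h2 h4
  rw [h1] at h4
  refine le_antisymm ?_ h4
  rw [← h2]
  exact mul_le_mul_of_nonneg_left h3 hc.le

/-- the function `x ↦ |⟨x, ξ⟩|` on the unit ball -/
def cosk (ξ : E) : C(closedBall (0 : E) 1, ℝ) :=
  ⟨fun x => |inner ℝ (x : E) ξ|, by fun_prop⟩

theorem cosk_dist (ξ η : E) : dist (cosk ξ) (cosk η) ≤ dist ξ η := by
  rw [ContinuousMap.dist_le dist_nonneg]
  rintro ⟨x, hx⟩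
  rw [mem_closedBall_zero_iff] at hx
  change dist |inner ℝ x ξ| |inner ℝ x η| ≤ _
  rw [Real.dist_eq]
  refine (abs_abs_sub_abs_le_abs_sub _ _).trans ?_
  rw [← inner_sub_right]
  refine (abs_real_inner_le_norm _ _).trans ?_
  rw [dist_eq_norm]
  exact mul_le_of_le_one_left (norm_nonneg _) hx

theorem continuous_cosk : Continuous (cosk : E → C(closedBall (0 : E) 1, ℝ)) :=
  (LipschitzWith.of_dist_le_mul (K := 1) fun x y => by simpa using cosk_dist x y).continuous

theorem neu_integral [MeasurableSpace E] [BorelSpace E] {m : Set E → ℂ} (hm : SV m)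
    (hinv : ∀ K, IsBody K → ∀ v, m (K + sg v) = m K) {ρ : E → ℝ} (hρ : ∀ ξ, 0 ≤ ρ ξ)
    (hρc : Continuous ρ) (hinteg : Integrable (fun ξ => ρ ξ * ‖ξ‖)) :
    Neu m (fun x => ∫ ξ, ρ ξ * |inner ℝ x ξ|) := by
  have hI : ∀ x : E, Integrable (fun ξ => ρ ξ * |inner ℝ x ξ|) := by
    intro x
    refine (hinteg.const_mul ‖x‖).mono' (by fun_prop) (Filter.Eventually.of_forall fun ξ => ?_)
    rw [Real.norm_eq_abs, abs_mul, abs_abs, abs_of_nonneg (hρ ξ)]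
    have := mul_le_mul_of_nonneg_left (abs_real_inner_le_norm x ξ) (hρ ξ)
    linarith
  refine neu_limit hm (R := ∫ ξ, ρ ξ * ‖ξ‖) ?_ ?_ ?_ ?_
  · intro x y
    rw [← integral_add (hI x) (hI y)]
    refine integral_mono (hI _) ((hI x).add (hI y)) fun ξ => ?_
    simp only
    rw [← mul_add, inner_add_left]
    exact mul_le_mul_of_nonneg_left (abs_add_le _ _) (hρ ξ)
  · intro c hc x
    rw [← integral_const_mul]
    congr 1 with ξ
    rw [real_inner_smul_left, abs_mul, abs_of_pos hc]
    ring
  · intro x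
    rw [← integral_mul_const]
    refine integral_mono (hI x) (hinteg.mul_const _) fun ξ => ?_
    have := mul_le_mul_of_nonneg_left (abs_real_inner_le_norm x ξ) (hρ ξ)
    simp only
    linarith
  · intro ε hε
    let S : PointedCone ℝ C(closedBall (0 : E) 1, ℝ) :=
      { carrier := {f | ∀ t : ℝ, 0 ≤ t → ∃ h, Neu m h ∧ ∀ x, t * f x = h x}
        add_mem' := by
          intro f g hf hg t ht
          obtain ⟨h, hn, hf⟩ := hf t ht
          obtain ⟨h', hn', hg⟩ := hg t ht
          exact ⟨_, hn.add hn', fun x => by simp [← hf, ← hg, mul_add]⟩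
        zero_mem' := fun t _ => ⟨_, neu_zero m, fun x => by simp⟩
        smul_mem' := by
          rintro ⟨c, hc⟩ f hf t ht
          obtain ⟨h, hn, hf⟩ := hf (t * c) (mul_nonneg ht hc)
          refine ⟨h, hn, fun x => ?_⟩
          rw [← hf, mul_assoc]
          rfl }
    have hF : Integrable (fun ξ => ρ ξ • cosk ξ) := by
      refine hinteg.mono' ?_ (Filter.Eventually.of_forall fun ξ => ?_)
      · exact (hρc.smul continuous_cosk).aestronglyMeasurable
      · rw [norm_smul, Real.norm_eq_abs, abs_of_nonneg (hρ ξ)]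
        refine mul_le_mul_of_nonneg_left ?_ (hρ ξ)
        have := cosk_dist ξ 0
        rw [dist_zero_right] at this
        have h0 : cosk (0 : E) = 0 := by ext x; simp [cosk]
        rwa [h0, dist_zero_right] at this
    have hev : ∀ x : closedBall (0 : E) 1, (∫ ξ, ρ ξ • cosk ξ) x = ∫ ξ, ρ ξ * |inner ℝ (x : E) ξ| :=
      fun x => ((ContinuousMap.evalCLM ℝ x).integral_comp_comm hF).symm
    have hmem : (∫ ξ, ρ ξ • cosk ξ) ∈ closure (S : Set C(closedBall (0 : E) 1, ℝ)) := by
      by_contra hnot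
      obtain ⟨f, hf1, hf2⟩ := ProperCone.hyperplane_separation_point (Submodule.closure S)
        (x₀ := ∫ ξ, ρ ξ • cosk ξ) hnot
      rw [← f.integral_comp_comm hF] at hf2
      refine absurd hf2 (not_lt.2 (integral_nonneg fun ξ => ?_))
      refine hf1 _ (subset_closure ?_)
      intro t ht
      refine ⟨_, neu_seg hm hinv ((t * ρ ξ) • ξ), fun x => ?_⟩
      rw [inner_smul_right, abs_mul, abs_of_nonneg (mul_nonneg ht (hρ ξ)), mul_assoc]
      rfl
    obtain ⟨f, hfS, hfd⟩ := Metric.mem_closure_iff.1 hmem ε hε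
    obtain ⟨h, hn, hfh⟩ := hfS 1 zero_le_one
    refine ⟨h, hn, fun x => ?_⟩
    obtain ⟨Z, -, hs, -⟩ := hn
    have hb : ∀ x : closedBall (0 : E) 1, |(∫ ξ, ρ ξ * |inner ℝ (x : E) ξ|) - h x| ≤ ε := by
      intro x
      rw [← hev, ← hfh, one_mul, ← Real.dist_eq]
      exact (ContinuousMap.dist_apply_le_dist x).trans hfd.le
    rcases eq_or_ne x 0 with rfl | hx
    · have : h 0 = 0 := by
        have := hs.hom (c := 2) (by norm_num) 0
        rw [smul_zero] at this
        linarith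
      simp [this]
    · have hxp : 0 < ‖x‖ := norm_pos_iff.2 hx
      have h1 := hb ⟨‖x‖⁻¹ • x, by
        rw [mem_closedBall_zero_iff, norm_smul, norm_inv, norm_norm, inv_mul_cancel₀ hxp.ne']⟩
      simp only at h1
      rw [hs.hom (inv_pos.2 hxp)] at h1
      have h2 : (∫ ξ, ρ ξ * |inner ℝ (‖x‖⁻¹ • x) ξ|) = ‖x‖⁻¹ * ∫ ξ, ρ ξ * |inner ℝ x ξ| := by
        rw [← integral_const_mul]
        congr 1 with ξ
        rw [real_inner_smul_left, abs_mul, abs_of_pos (inv_pos.2 hxp)]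
        ring
      rw [h2, ← mul_sub, abs_mul, abs_of_pos (inv_pos.2 hxp), inv_mul_le_iff₀ hxp] at h1
      linarith

end Support


section Analytic

variable {E : Type*} [NormedAddCommGroup E] [InnerProductSpace ℝ E] [FiniteDimensional ℝ E]
  [MeasurableSpace E] [BorelSpace E]

open scoped ContDiff FourierTransform SchwartzMap

theorem exists_cos_rep {f : E → ℝ} (hf : ContDiff ℝ ∞ f) (hc : HasCompactSupport f)
    (he : ∀ x, f (-x) = f x) : ∃ w : E → ℝ, Continuous w ∧ Integrable w ∧
      Integrable (fun ξ => w ξ * ‖ξ‖) ∧ ∀ x, f x = ∫ ξ, w ξ * Real.cos (2 * Real.pi * inner ℝ ξ x) := by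
  have hf' : ContDiff ℝ ∞ (fun x => (f x : ℂ)) := Complex.ofRealCLM.contDiff.comp hf
  have hc' : HasCompactSupport (fun x => (f x : ℂ)) := hc.comp_left (g := Complex.ofReal) rfl
  set g : 𝓢(E, ℂ) := hc'.toSchwartzMap hf' with hg
  have hgx : ∀ x, g x = f x := fun x => rfl
  set W : 𝓢(E, ℂ) := 𝓕 g with hW
  have hinv : ∀ x, (f x : ℂ) = ∫ ξ, Complex.exp (↑(2 * Real.pi * inner ℝ ξ x) * Complex.I) • W ξ := by
    intro x
    rw [← Real.fourierInv_eq', ← SchwartzMap.fourierInv_coe, hW, FourierTransform.fourierInv_fourier_eq, hgx]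
  have hWi : Integrable W := W.integrable
  have hWn : Integrable (fun ξ => ‖ξ‖ * ‖W ξ‖) := by
    simpa using W.integrable_pow_mul volume 1
  have hWc : Continuous W := W.continuous
  have hcosm : ∀ x : E, Continuous fun ξ : E => Real.cos (2 * Real.pi * inner ℝ ξ x) := by
    intro x; fun_prop
  have hei : ∀ x, Integrable (fun ξ => Complex.exp (↑(2 * Real.pi * inner ℝ ξ x) * Complex.I) • W ξ) := by
    intro x
    refine hWi.norm.mono' (by fun_prop) (Filter.Eventually.of_forall fun ξ => ?_)
    rw [norm_smul, Complex.norm_exp_ofReal_mul_I, one_mul]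
  refine ⟨fun ξ => (W ξ).re, by fun_prop, hWi.re, ?_, fun x => ?_⟩
  · refine hWn.mono' (by fun_prop) (Filter.Eventually.of_forall fun ξ => ?_)
    rw [norm_mul, norm_norm, mul_comm]
    exact mul_le_mul_of_nonneg_left (Complex.abs_re_le_norm _) (norm_nonneg _)
  · have h1 := hinv x
    have h2 := hinv (-x)
    rw [he] at h2
    have h3 : (2 : ℂ) * f x = ∫ ξ, (2 : ℂ) * ((Real.cos (2 * Real.pi * inner ℝ ξ x) : ℝ) * W ξ) := by
      calc (2 : ℂ) * f x = f x + f x := two_mul _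
        _ = _ := by
          nth_rewrite 1 [h1]
          rw [h2, ← integral_add (hei x) (hei (-x))]
          congr 1 with ξ
          rw [inner_neg_right, smul_eq_mul, smul_eq_mul, ← add_mul, Complex.ofReal_cos, ← mul_assoc,
            Complex.two_cos]
          push_cast
          ring_nf
    rw [integral_const_mul] at h3
    have h4 := mul_left_cancel₀ two_ne_zero h3
    have hi : Integrable (fun ξ => ((Real.cos (2 * Real.pi * inner ℝ ξ x) : ℝ) : ℂ) * W ξ) := by
      refine hWi.norm.mono' (by fun_prop) (Filter.Eventually.of_forall fun ξ => ?_)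
      rw [norm_mul, Complex.norm_real]
      exact mul_le_of_le_one_left (norm_nonneg _) (Real.abs_cos_le_one _)
    have h5 := congrArg Complex.re h4
    rw [Complex.ofReal_re] at h5
    rw [h5]
    have := integral_re hi
    simp only [RCLike.re_eq_complex_re] at this
    rw [← this]
    congr 1 with ξ
    rw [Complex.re_ofReal_mul, mul_comm]

theorem one_sub_cos_bound (r : ℝ) : (1 - Real.cos r) / r ^ 2 ≤ 4 * (1 + r ^ 2)⁻¹ := by
  rcases eq_or_ne r 0 with rfl | hr
  · simp
  have h2 : 0 < r ^ 2 := by positivity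
  rw [← div_eq_mul_inv, div_le_div_iff₀ h2 (by positivity)]
  have h1 := Real.one_sub_sq_div_two_le_cos (x := r)
  have h3 := Real.neg_one_le_cos r
  nlinarith

/-- a constant -/
def Dc : ℝ := ∫ r in Ioi (0 : ℝ), (1 - Real.cos r) / r ^ 2

theorem integrable_one_sub_cos (s : ℝ) :
    IntegrableOn (fun r : ℝ => (1 - Real.cos (r * s)) / r ^ 2) (Ioi 0) := by
  have h1 : Integrable (fun r : ℝ => (1 - Real.cos r) / r ^ 2) := by
    refine (integrable_inv_one_add_sq.const_mul 4).mono' (Measurable.aestronglyMeasurable (by fun_prop)) (Filter.Eventually.of_forall fun r => ?_)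
    rw [Real.norm_of_nonneg (div_nonneg (sub_nonneg.2 (Real.cos_le_one r)) (sq_nonneg r))]
    exact one_sub_cos_bound r
  rcases eq_or_ne s 0 with rfl | hs
  · simp
  have h2 := ((h1.comp_mul_right' hs).const_mul (s ^ 2)).integrableOn (s := Ioi 0)
  refine h2.congr_fun (fun r hr => ?_) measurableSet_Ioi
  have : r ≠ 0 := ne_of_gt hr
  simp only
  field_simp

theorem integral_one_sub_cos (s : ℝ) :
    ∫ r in Ioi (0 : ℝ), (1 - Real.cos (r * s)) / r ^ 2 = |s| * Dc := by
  rcases eq_or_ne s 0 with rfl | hs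
  · simp
  have hs' : 0 < |s| := abs_pos.2 hs
  have := integral_comp_mul_left_Ioi (fun r : ℝ => (1 - Real.cos r) / r ^ 2) 0 hs'
  rw [mul_zero] at this
  rw [Dc, ← mul_inv_cancel_left₀ hs'.ne' (∫ r in Ioi (0 : ℝ), (1 - Real.cos r) / r ^ 2),
    ← smul_eq_mul (|s|⁻¹), ← this, ← mul_assoc, ← integral_const_mul]
  refine setIntegral_congr_fun measurableSet_Ioi (fun r hr => ?_)
  have : r ≠ 0 := ne_of_gt hr
  have h1 : Real.cos (r * s) = Real.cos (|s| * r) := by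
    rw [← Real.cos_abs, abs_mul, abs_of_pos hr, mul_comm]
  simp only [h1]
  field_simp

theorem exists_abs_rep {h : E → ℝ} {k : ℕ} (hk : k ≠ 0) {c : ℝ} (hc : 0 < c)
    (hlow : ∀ x, c * ‖x‖ ≤ h x) (hhom : ∀ r, 0 < r → ∀ x, h (r • x) = r * h x)
    (heven : ∀ x, h (-x) = h x) (hsm : ContDiff ℝ ∞ (fun x => h x ^ (2 * k))) :
    ∃ w : E → ℝ, Continuous w ∧ Integrable (fun ξ => w ξ * ‖ξ‖) ∧
      ∀ x, h x = ∫ ξ, w ξ * |inner ℝ x ξ| := by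
  have hh0 : ∀ x, 0 ≤ h x := fun x => (mul_nonneg hc.le (norm_nonneg x)).trans (hlow x)
  let χ : ContDiffBump (0 : ℝ) := ⟨1, 2, one_pos, one_lt_two⟩
  have hχ1 : ∀ s : ℝ, |s| ≤ 1 → χ s = 1 := fun s hs =>
    χ.one_of_mem_closedBall (by simpa [χ] using hs)
  have hχ2 : ∀ s : ℝ, 2 ≤ |s| → χ s = 0 := fun s hs =>
    χ.zero_of_le_dist (by simpa [χ] using hs)
  have hφ1 : ∀ s : ℝ, 0 ≤ s → s ≤ 1 → χ (s ^ (2 * k)) = 1 := fun s h0 hs =>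
    hχ1 _ (by rw [abs_of_nonneg (by positivity)]; exact pow_le_one₀ h0 hs)
  have hφ2 : ∀ s : ℝ, 2 ≤ s → χ (s ^ (2 * k)) = 0 := fun s hs =>
    hχ2 _ (by
      rw [abs_of_nonneg (by positivity)]
      exact hs.trans (le_self_pow₀ (by linarith) (by omega)))
  set f : E → ℝ := fun x => χ (h x ^ (2 * k)) with hfdef
  have hf : ContDiff ℝ ∞ f := χ.contDiff.comp hsm
  have hfc : HasCompactSupport f := by
    refine HasCompactSupport.intro (isCompact_closedBall (0 : E) (2 / c)) fun x hx => ?_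
    rw [mem_closedBall_zero_iff, not_le, div_lt_iff₀ hc] at hx
    exact hφ2 _ (by linarith [hlow x])
  obtain ⟨w, hwc, hwi, hwn, hw⟩ := exists_cos_rep hf hfc (fun x => by simp only [hfdef, heven])
  have hh00 : h 0 = 0 := by
    have := hhom 2 two_pos 0
    rw [smul_zero] at this; linarith
  have hf0 : f 0 = 1 := by
    simp only [hfdef, hh00]; exact hφ1 0 le_rfl zero_le_one
  set C : ℝ := ∫ s in Ioi (0 : ℝ), (1 - χ (s ^ (2 * k))) / s ^ 2 with hC
  have hnn : ∀ s : ℝ, 0 ≤ (1 - χ (s ^ (2 * k))) / s ^ 2 := fun s =>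
    div_nonneg (sub_nonneg.2 χ.le_one) (sq_nonneg s)
  have hCi : IntegrableOn (fun s : ℝ => (1 - χ (s ^ (2 * k))) / s ^ 2) (Ioi 0) := by
    have hm : Measurable (fun s : ℝ => (1 - χ (s ^ (2 * k))) / s ^ 2) := by
      have : Measurable χ := χ.continuous.measurable
      fun_prop
    refine (integrable_inv_one_add_sq.const_mul 2).integrableOn.mono' hm.aestronglyMeasurable ?_
    refine (ae_restrict_iff' measurableSet_Ioi).2 (Filter.Eventually.of_forall fun s hs => ?_)
    rw [Real.norm_of_nonneg (hnn s)]
    have hs' : (0 : ℝ) < s := hs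
    rcases le_or_gt s 1 with h1 | h1
    · rw [hφ1 s hs'.le h1]; simp; positivity
    · rw [← div_eq_mul_inv, div_le_div_iff₀ (by positivity) (by positivity)]
      have : 0 ≤ χ (s ^ (2 * k)) := χ.nonneg
      nlinarith
  have hCpos : 0 < C := by
    have h1 : ∫ s in Ioc (2 : ℝ) 3, (1 - χ (s ^ (2 * k))) / s ^ 2 ≤ C :=
      setIntegral_mono_set hCi (Filter.Eventually.of_forall hnn)
        (Filter.Eventually.of_forall fun s (hs : s ∈ Ioc (2 : ℝ) 3) => lt_trans two_pos hs.1)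
    have h2 : (∫ s in Ioc (2 : ℝ) 3, (1 / 9 : ℝ)) ≤ ∫ s in Ioc (2 : ℝ) 3, (1 - χ (s ^ (2 * k))) / s ^ 2 := by
      refine setIntegral_mono_on (by simp) (hCi.mono_set fun s hs => lt_trans two_pos hs.1)
        measurableSet_Ioc fun s hs => ?_
      rw [hφ2 s hs.1.le, sub_zero]
      have : (0 : ℝ) < s := lt_trans two_pos hs.1
      exact one_div_le_one_div_of_le (by positivity) (by nlinarith [hs.2])
    have h3 : (∫ s in Ioc (2 : ℝ) 3, (1 / 9 : ℝ)) = 1 / 9 := by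
      rw [setIntegral_const]; norm_num [Measure.real]
    linarith [h1, h2, h3]
  have hL : ∀ x, ∫ r in Ioi (0 : ℝ), (f 0 - f (r • x)) / r ^ 2 = h x * C := by
    intro x
    rcases (hh0 x).eq_or_lt with h0 | hpos
    · rw [← h0, zero_mul]
      refine (setIntegral_congr_fun (g := fun _ => (0 : ℝ)) measurableSet_Ioi (fun r hr => ?_)).trans (by simp)
      simp only [hfdef, hhom r hr, ← h0, hh00]; simp
    have := integral_comp_mul_left_Ioi (fun s : ℝ => (1 - χ (s ^ (2 * k))) / s ^ 2) 0 hpos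
    rw [mul_zero] at this
    rw [hC, ← mul_inv_cancel_left₀ hpos.ne' (∫ s in Ioi (0 : ℝ), (1 - χ (s ^ (2 * k))) / s ^ 2),
      ← smul_eq_mul ((h x)⁻¹), ← this, ← mul_assoc, ← integral_const_mul]
    refine setIntegral_congr_fun measurableSet_Ioi (fun r hr => ?_)
    have hr0 : r ≠ 0 := ne_of_gt hr
    simp only [hf0]
    simp only [hfdef, hhom r hr, mul_comm r]
    field_simp
  have hDnn : 0 ≤ Dc := integral_nonneg fun r => div_nonneg (sub_nonneg.2 (Real.cos_le_one r)) (sq_nonneg r)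
  have hcosi : ∀ y : E, Integrable (fun ξ => w ξ * Real.cos (2 * Real.pi * inner ℝ ξ y)) := by
    intro y
    refine hwi.norm.mono' (by fun_prop) (Filter.Eventually.of_forall fun ξ => ?_)
    rw [norm_mul]
    exact mul_le_of_le_one_right (norm_nonneg _) (Real.abs_cos_le_one _)
  have hdiff : ∀ r : ℝ, ∀ x : E, (f 0 - f (r • x)) / r ^ 2 =
      ∫ ξ, w ξ * ((1 - Real.cos (r * (2 * Real.pi * inner ℝ ξ x))) / r ^ 2) := by
    intro r x
    rw [hw, hw, ← integral_sub (hcosi _) (hcosi _), ← integral_div]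
    congr 1 with ξ
    rw [inner_zero_right, mul_zero, Real.cos_zero, inner_smul_right]
    ring_nf
  refine ⟨fun ξ => (C⁻¹ * (2 * Real.pi) * Dc) * w ξ, by fun_prop, ?_, fun x => ?_⟩
  · simpa [mul_assoc] using hwn.const_mul (C⁻¹ * (2 * Real.pi) * Dc)
  have hmeas : Measurable (Function.uncurry fun (r : ℝ) (ξ : E) =>
      w ξ * ((1 - Real.cos (r * (2 * Real.pi * inner ℝ ξ x))) / r ^ 2)) := by
    have : Measurable w := hwc.measurable
    have h2 : Measurable (fun ξ : E => inner ℝ ξ x) := by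
      have : Continuous (fun ξ : E => inner ℝ ξ x) := by fun_prop
      exact this.measurable
    unfold Function.uncurry
    fun_prop
  have hinteg : Integrable (Function.uncurry fun (r : ℝ) (ξ : E) =>
      w ξ * ((1 - Real.cos (r * (2 * Real.pi * inner ℝ ξ x))) / r ^ 2))
      ((volume.restrict (Ioi (0 : ℝ))).prod volume) := by
    rw [integrable_prod_iff' hmeas.aestronglyMeasurable]
    have hno : ∀ (ξ : E), ∫ r in Ioi (0 : ℝ), ‖w ξ * ((1 - Real.cos (r * (2 * Real.pi * inner ℝ ξ x))) / r ^ 2)‖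
        = ‖w ξ‖ * (|2 * Real.pi * inner ℝ ξ x| * Dc) := by
      intro ξ
      rw [← integral_one_sub_cos, ← integral_const_mul]
      congr 1 with r
      rw [norm_mul, Real.norm_of_nonneg (div_nonneg (sub_nonneg.2 (Real.cos_le_one _)) (sq_nonneg _))]
    refine ⟨Filter.Eventually.of_forall fun ξ => (integrable_one_sub_cos (2 * Real.pi * inner ℝ ξ x)).const_mul (w ξ), ?_⟩
    simp only [Function.uncurry_apply_pair, hno]
    refine ((hwn.norm.const_mul (2 * Real.pi * ‖x‖ * Dc))).mono' (by fun_prop)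
      (Filter.Eventually.of_forall fun ξ => ?_)
    rw [Real.norm_of_nonneg (by positivity), norm_mul, norm_norm, abs_mul, abs_of_nonneg (by positivity : 0 ≤ 2 * Real.pi)]
    have := abs_real_inner_le_norm ξ x
    calc ‖w ξ‖ * (2 * Real.pi * |inner ℝ ξ x| * Dc) ≤ ‖w ξ‖ * (2 * Real.pi * (‖ξ‖ * ‖x‖) * Dc) := by gcongr
      _ = _ := by ring
  have hfub := integral_integral_swap hinteg
  simp only [integral_const_mul, integral_one_sub_cos, ← hdiff] at hfub
  rw [hL] at hfub
  rw [← mul_right_cancel_iff_of_pos hCpos, hfub, ← integral_mul_const]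
  congr 1 with ξ
  rw [abs_mul, abs_of_nonneg (by positivity : 0 ≤ 2 * Real.pi), real_inner_comm ξ x]
  field_simp

end Analytic


section Symm

variable {E : Type*} [NormedAddCommGroup E] [InnerProductSpace ℝ E] [FiniteDimensional ℝ E]

open scoped ContDiff

/-- the smooth norms -/
def nk {ι : Type*} [Fintype ι] (u : ι → E) (k : ℕ) (x : E) : ℝ :=
  (∑ i, |inner ℝ (u i) x| ^ ((2 * k : ℕ) : ℝ)) ^ (1 / ((2 * k : ℕ) : ℝ))

section nk
variable {ι : Type*} [Fintype ι] (u : ι → E) {k : ℕ}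

theorem nk_pow (hk : k ≠ 0) (x : E) : nk u k x ^ (2 * k) = ∑ i, (inner ℝ (u i) x) ^ (2 * k) := by
  have h0 : 0 ≤ ∑ i, |inner ℝ (u i) x| ^ ((2 * k : ℕ) : ℝ) :=
    Finset.sum_nonneg fun i _ => by positivity
  rw [nk, one_div, Real.rpow_inv_natCast_pow h0 (by omega)]
  refine Finset.sum_congr rfl fun i _ => ?_
  rw [Real.rpow_natCast, Even.pow_abs (even_two_mul k)]

theorem nk_nonneg (_hk : k ≠ 0) (x : E) : 0 ≤ nk u k x :=
  Real.rpow_nonneg (Finset.sum_nonneg fun i _ => by positivity) _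

theorem nk_add (hk : k ≠ 0) (x y : E) : nk u k (x + y) ≤ nk u k x + nk u k y := by
  have := Real.Lp_add_le Finset.univ (fun i => inner ℝ (u i) x) (fun i => inner ℝ (u i) y)
    (p := ((2 * k : ℕ) : ℝ)) (by exact_mod_cast (by omega : 1 ≤ 2 * k))
  simpa [nk, inner_add_right] using this

theorem nk_hom (hk : k ≠ 0) (r : ℝ) (hr : 0 < r) (x : E) : nk u k (r • x) = r * nk u k x := by
  rw [← pow_left_inj₀ (nk_nonneg u hk _) (mul_nonneg hr.le (nk_nonneg u hk _)) (by omega : 2 * k ≠ 0),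
    mul_pow, nk_pow u hk, nk_pow u hk, Finset.mul_sum]
  refine Finset.sum_congr rfl fun i _ => ?_
  rw [inner_smul_right, mul_pow]

theorem nk_neg (_hk : k ≠ 0) (x : E) : nk u k (-x) = nk u k x := by
  simp [nk]

theorem nk_smooth (hk : k ≠ 0) : ContDiff ℝ ∞ (fun x => nk u k x ^ (2 * k)) := by
  simp only [nk_pow u hk]
  refine ContDiff.sum fun i _ => ?_
  exact (contDiff_const.inner ℝ contDiff_id).pow _

theorem le_nk (hk : k ≠ 0) (x : E) (i : ι) : |inner ℝ (u i) x| ≤ nk u k x := by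
  rw [← pow_le_pow_iff_left₀ (abs_nonneg _) (nk_nonneg u hk _) (by omega : 2 * k ≠ 0), nk_pow u hk,
    Even.pow_abs (even_two_mul k)]
  exact Finset.single_le_sum (f := fun i => (inner ℝ (u i) x) ^ (2 * k))
    (fun i _ => Even.pow_nonneg (even_two_mul k) _) (Finset.mem_univ i)

theorem nk_le (hk : k ≠ 0) (x : E) {M c : ℝ} (hM : ∀ i, |inner ℝ (u i) x| ≤ M) (hM0 : 0 ≤ M) (hc : 0 ≤ c)
    (hcN : (Fintype.card ι : ℝ) ≤ c ^ (2 * k)) : nk u k x ≤ c * M := by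
  rw [← pow_le_pow_iff_left₀ (nk_nonneg u hk _) (mul_nonneg hc hM0) (by omega : 2 * k ≠ 0), nk_pow u hk,
    mul_pow]
  calc ∑ i, (inner ℝ (u i) x) ^ (2 * k) ≤ ∑ i : ι, M ^ (2 * k) := by
        refine Finset.sum_le_sum fun i _ => ?_
        rw [← Even.pow_abs (even_two_mul k)]
        exact pow_le_pow_left₀ (abs_nonneg _) (hM i) _
    _ = (Fintype.card ι : ℝ) * M ^ (2 * k) := by simp
    _ ≤ _ := mul_le_mul_of_nonneg_right hcN (by positivity)

end nk

theorem SV.smooth_zero {m : Set E → ℂ} (hm : SV m) (hinv : ∀ K, IsBody K → ∀ v, m (K + sg v) = m K)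
    {v : E} (hv : v ≠ 0) {h : E → ℝ} {k : ℕ} (hk : k ≠ 0) {c : ℝ} (hc : 0 < c)
    (hlow : ∀ x, c * ‖x‖ ≤ h x) (hhom : ∀ r, 0 < r → ∀ x, h (r • x) = r * h x)
    (heven : ∀ x, h (-x) = h x) (hsm : ContDiff ℝ ∞ (fun x => h x ^ (2 * k)))
    {K : Set E} (hK : IsBody K) (hs : IsSupp h K) : m K = 0 := by
  letI : MeasurableSpace E := borel E
  haveI : BorelSpace E := ⟨rfl⟩
  obtain ⟨w, hwc, hwi, hw⟩ := exists_abs_rep hk hc hlow hhom heven hsm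
  have hi1 : Integrable (fun ξ => max (w ξ) 0 * ‖ξ‖) := by
    refine hwi.norm.mono' (by fun_prop) (Filter.Eventually.of_forall fun ξ => ?_)
    rw [norm_mul, norm_mul]
    gcongr
    rw [Real.norm_eq_abs, Real.norm_eq_abs, abs_of_nonneg (le_max_right _ _)]
    exact max_le (le_abs_self _) (abs_nonneg _)
  have hi2 : Integrable (fun ξ => max (-w ξ) 0 * ‖ξ‖) := by
    refine hwi.norm.mono' (by fun_prop) (Filter.Eventually.of_forall fun ξ => ?_)
    rw [norm_mul, norm_mul]
    gcongr
    rw [Real.norm_eq_abs, Real.norm_eq_abs, abs_of_nonneg (le_max_right _ _)]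
    exact max_le (neg_le_abs _) (abs_nonneg _)
  have hi : ∀ ρ : E → ℝ, Continuous ρ → (∀ ξ, 0 ≤ ρ ξ) → Integrable (fun ξ => ρ ξ * ‖ξ‖) → ∀ x,
      Integrable (fun ξ => ρ ξ * |inner ℝ x ξ|) := by
    intro ρ h1 h2 h3 x
    refine (h3.const_mul ‖x‖).mono' (by fun_prop) (Filter.Eventually.of_forall fun ξ => ?_)
    rw [Real.norm_of_nonneg (mul_nonneg (h2 ξ) (abs_nonneg _))]
    calc _ ≤ ρ ξ * (‖x‖ * ‖ξ‖) := mul_le_mul_of_nonneg_left (abs_real_inner_le_norm _ _) (h2 ξ)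
      _ = _ := by ring
  obtain ⟨Zp, bp, sp, np⟩ := neu_integral hm hinv (ρ := fun ξ => max (w ξ) 0) (fun ξ => le_max_right _ _)
    (by fun_prop) hi1
  obtain ⟨Zm, bm, sm, nm⟩ := neu_integral hm hinv (ρ := fun ξ => max (-w ξ) 0) (fun ξ => le_max_right _ _)
    (by fun_prop) hi2
  have hadd := hs.add sm
  have heq : (fun x => h x + ∫ ξ, max (-w ξ) 0 * |inner ℝ x ξ|) =
      fun x => ∫ ξ, max (w ξ) 0 * |inner ℝ x ξ| := by
    funext x
    have hd : h x = (∫ ξ, max (w ξ) 0 * |inner ℝ x ξ|) - ∫ ξ, max (-w ξ) 0 * |inner ℝ x ξ| := by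
      rw [← integral_sub (hi _ (by fun_prop) (fun ξ => le_max_right _ _) hi1 x)
        (hi _ (by fun_prop) (fun ξ => le_max_right _ _) hi2 x), hw]
      congr 1 with ξ
      rw [← sub_mul]
      congr 1
      rcases le_total (w ξ) 0 with h1 | h1
      · rw [max_eq_right h1, max_eq_left (by linarith)]; ring
      · rw [max_eq_left h1, max_eq_right (by linarith)]; ring
    rw [hd]; ring
  rw [heq] at hadd
  have hKZ : K + Zm = Zp := eq_of_isSupp hadd sp (hK.add bm) bp
  rw [← nm K hK, hKZ]
  have h0 := np {0} (isBody_singleton 0)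
  rw [Set.singleton_add, show (fun x : E => (0 : E) + x) = id by funext x; simp, image_id] at h0
  rw [h0]
  exact hm.simple {0} v 0 (isBody_singleton 0) hv (by simp)

theorem SV.symm_zero_aux {m : Set E → ℂ} (hm : SV m) (hinv : ∀ K, IsBody K → ∀ v, m (K + sg v) = m K)
    {v : E} (hv : v ≠ 0) {B : Set E} (hB : IsBody B) (hsym : -B = B) {h : E → ℝ} (hs : IsSupp h B)
    {δ₀ : ℝ} (hδ₀ : 0 < δ₀) (hlow : ∀ x, δ₀ * ‖x‖ ≤ h x) : m B = 0 := by
  refine hm.eq_zero_of_close hB fun δ hδ => ?_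
  obtain ⟨R, hR0, hR⟩ : ∃ R > 0, ∀ x ∈ B, ‖x‖ ≤ R := by
    obtain ⟨R, hR⟩ := hB.2.1.isBounded.exists_norm_le
    exact ⟨max R 1, by positivity, fun x hx => (hR x hx).trans (le_max_left _ _)⟩
  have hhR : ∀ x, h x ≤ R * ‖x‖ := by
    intro x
    obtain ⟨y, hy, e⟩ := (hs x).2
    rw [← e]
    calc _ ≤ ‖x‖ * ‖y‖ := real_inner_le_norm _ _
      _ ≤ ‖x‖ * R := by gcongr; exact hR y hy
      _ = _ := mul_comm _ _
  have hab : ∀ x, ∀ u ∈ B, |inner ℝ u x| ≤ h x := by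
    intro x u hu
    refine abs_le'.2 ⟨?_, ?_⟩
    · rw [real_inner_comm]; exact (hs x).1 u hu
    · have : -u ∈ B := by rw [← hsym]; simpa
      have := (hs x).1 _ this
      rwa [inner_neg_right, real_inner_comm] at this
  set η := min δ (δ₀ / 2) with hη
  have hηp : 0 < η := by positivity
  obtain ⟨T, hTB, hTf, hT⟩ := hB.2.1.finite_cover_balls hηp
  haveI := hTf.fintype
  obtain ⟨k, hk0, hkN⟩ : ∃ k : ℕ, k ≠ 0 ∧ (Fintype.card T : ℝ) ≤ (1 + δ / R) ^ (2 * k) := by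
    obtain ⟨k, hk⟩ := pow_unbounded_of_one_lt (Fintype.card T : ℝ) (by
      have : 0 < δ / R := by positivity
      linarith : 1 < 1 + δ / R)
    refine ⟨k + 1, by omega, hk.le.trans (pow_le_pow_right₀ ?_ (by omega))⟩
    have : 0 < δ / R := by positivity
    linarith
  set u : T → E := fun i => i
  have hup : ∀ x, nk u k x ≤ (1 + δ / R) * h x := fun x =>
    nk_le u hk0 x (fun i => hab x i (hTB i.2)) ((by positivity : 0 ≤ δ₀ * ‖x‖).trans (hlow x)) (by positivity) hkN
  have hdn : ∀ x, h x - η * ‖x‖ ≤ nk u k x := by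
    intro x
    obtain ⟨y, hy, e⟩ := (hs x).2
    obtain ⟨t, ht, hyt⟩ := mem_iUnion₂.1 (hT hy)
    have h1 := le_nk u hk0 x ⟨t, ht⟩
    have h2 : inner ℝ x (y - t) ≤ ‖x‖ * η :=
      (real_inner_le_norm _ _).trans (by
        gcongr
        rw [← dist_eq_norm]; exact (mem_ball.1 hyt).le)
    rw [inner_sub_right, e] at h2
    have h3 := le_abs_self (inner ℝ t x)
    rw [real_inner_comm] at h3
    rw [real_inner_comm] at h3
    have h4 : inner ℝ x t = inner ℝ t x := real_inner_comm _ _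
    have h5 : |inner ℝ t x| ≤ nk u k x := h1
    linarith
  have hRb : ∀ x, nk u k x ≤ ((1 + δ / R) * R) * ‖x‖ := fun x =>
    (hup x).trans (by rw [mul_assoc]; gcongr; exact hhR x)
  obtain ⟨K, bK, sK⟩ := wulff (nk_add u hk0) (nk_hom u hk0) hRb
  refine ⟨K, bK, HClose_of_isSupp hs sK hB bK hδ.le fun x => ?_, ?_⟩
  · rw [abs_le]
    constructor
    · have h1 := hup x
      have h2 : δ / R * h x ≤ δ * ‖x‖ := by
        calc _ ≤ δ / R * (R * ‖x‖) := by gcongr; exact hhR x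
          _ = _ := by field_simp
      linarith
    · have : η * ‖x‖ ≤ δ * ‖x‖ := by gcongr; exact min_le_left _ _
      linarith [hdn x]
  · refine hm.smooth_zero hinv hv hk0 (half_pos hδ₀) (fun x => ?_) (nk_hom u hk0) (nk_neg u hk0)
      (nk_smooth u hk0) bK sK
    have : η * ‖x‖ ≤ δ₀ / 2 * ‖x‖ := by gcongr; exact min_le_right _ _
    linarith [hdn x, hlow x]

theorem SV.symm_zero {m : Set E → ℂ} (hm : SV m) (hg : ∀ v ≠ 0, Good m v)
    {v : E} (hv : v ≠ 0) {B : Set E} (hB : IsBody B) (hsym : -B = B) : m B = 0 := by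
  have hinv : ∀ K, IsBody K → ∀ v, m (K + sg v) = m K := by
    intro K hK v
    rcases eq_or_ne v 0 with rfl | hv
    · have : sg (0 : E) = {0} := by
        ext x; rw [mem_sg, mem_singleton_iff]
        exact ⟨by rintro ⟨s, -, -, rfl⟩; simp, fun h => ⟨0, le_rfl, zero_le_one, by simp [h]⟩⟩
      rw [this, Set.add_singleton]; simp
    · exact (hg v hv).add_sg hm hv hK
  refine hm.eq_zero_of_close hB fun δ hδ => ?_
  have hb : IsBody (closedBall (0 : E) δ) :=
    ⟨convex_closedBall 0 δ, isCompact_closedBall 0 δ, ⟨0, by simp [hδ.le]⟩⟩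
  have hBb := hB.add hb
  obtain ⟨h, hs⟩ := exists_isSupp hBb
  refine ⟨B + closedBall 0 δ, hBb, ⟨fun x hx => ⟨x, ?_, by simp [hδ.le]⟩, ?_⟩, ?_⟩
  · exact ⟨x, hx, 0, by simp [hδ.le], by simp⟩
  · rintro y ⟨b, hb, z, hz, rfl⟩
    refine ⟨b, hb, ?_⟩
    simpa using hz
  refine hm.symm_zero_aux hinv hv hBb ?_ hs hδ fun x => ?_
  · rw [neg_add, hsym, neg_closedBall, neg_zero]
  · obtain ⟨b, hb⟩ := hB.2.2
    have h0 : ∃ b ∈ B, 0 ≤ inner ℝ x b := by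
      rcases le_total 0 (inner ℝ x b) with h | h
      · exact ⟨b, hb, h⟩
      · refine ⟨-b, by rw [← hsym]; simpa, by rw [inner_neg_right]; linarith⟩
    obtain ⟨b, hb, hxb⟩ := h0
    rcases eq_or_ne x 0 with rfl | hx
    · have := (hs 0).1 b ⟨b, hb, 0, by simp [hδ.le], by simp⟩
      simpa using this
    have hxp : 0 < ‖x‖ := norm_pos_iff.2 hx
    have := (hs x).1 (b + (δ / ‖x‖) • x) ⟨b, hb, _, ?_, rfl⟩
    · rw [inner_add_right, inner_smul_right, real_inner_self_eq_norm_sq] at this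
      have h2 : δ / ‖x‖ * ‖x‖ ^ 2 = δ * ‖x‖ := by field_simp
      linarith
    · rw [mem_closedBall_zero_iff, norm_smul, norm_div, norm_norm, div_mul_cancel₀ _ hxp.ne',
        Real.norm_of_nonneg hδ.le]

end Symm


section Klain

variable {E : Type*} [NormedAddCommGroup E] [InnerProductSpace ℝ E] [FiniteDimensional ℝ E]

theorem SV.symm_zero' {m : Set E → ℂ} (hm : SV m) (hg : ∀ v ≠ 0, Good m v)
    {v : E} (hv : v ≠ 0) {B : Set E} (hB : IsBody B) {q : E} (hsym : ∀ x ∈ B, q - x ∈ B) : m B = 0 := by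
  rw [← hm.trans (-((1 / 2 : ℝ) • q)) B hB]
  refine hm.symm_zero hg hv ((isBody_singleton _).add hB) ?_
  have hsub : ∀ y, y ∈ ({-((1 / 2 : ℝ) • q)} : Set E) + B → -y ∈ ({-((1 / 2 : ℝ) • q)} : Set E) + B := by
    intro y hy
    obtain ⟨x, hx, rfl⟩ := mem_singleton_add.1 hy
    refine mem_singleton_add.2 ⟨q - x, hsym x hx, ?_⟩
    module
  ext y
  refine ⟨fun hy => ?_, fun hy => hsub y hy⟩
  have := hsub _ hy
  rwa [neg_neg] at this

theorem SV.klain {m : Set E → ℂ} (hm : SV m) (hp : Par 1 m) (hg : ∀ v ≠ 0, Good m v)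
    {v : E} (hv : v ≠ 0) {K : Set E} (hK : IsBody K) : m K = 0 := by
  refine hm.reduce_cone hv (fun u l hl hb => ?_) hK
  set C := HPoly l with hC
  have hCm : ∀ x, x ∈ C ↔ ∀ r ∈ l, inner ℝ r.1 x ≤ 0 := by
    intro x
    refine forall₂_congr fun r hr => ?_
    rw [hl r hr]
  have hC1 : HPoly ((u, 1) :: l) = {x | inner ℝ u x ≤ 1} ∩ C := poly_cons _ _
  rw [hC1] at hb ⊢
  set C₁ := {x | inner ℝ u x ≤ 1} ∩ C with hC₁
  have hCadd : ∀ x ∈ C, ∀ y ∈ C, x + y ∈ C := by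
    intro x hx y hy
    rw [hCm] at hx hy ⊢
    intro r hr
    rw [inner_add_right]
    linarith [hx r hr, hy r hr]
  have hCsm : ∀ s : ℝ, 0 ≤ s → ∀ x ∈ C, s • x ∈ C := by
    intro s hs x hx
    rw [hCm] at hx ⊢
    intro r hr
    rw [inner_smul_right]
    exact mul_nonpos_of_nonneg_of_nonpos hs (hx r hr)
  have hC0 : (0 : E) ∈ C := by rw [hCm]; intro r _; simp
  have hupos : ∀ x ∈ C, x ≠ 0 → 0 < inner ℝ u x := by
    intro x hx hx0
    by_contra hneg
    push Not at hneg
    refine not_isCompact_of_ray hx0 (x := 0) (A := C₁) (fun s hs => ⟨?_, ?_⟩) hb.2.1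
    · rw [zero_add, Set.mem_setOf_eq, inner_smul_right]
      nlinarith
    · rw [zero_add]; exact hCsm s hs x hx
  have hunn : ∀ x ∈ C, 0 ≤ inner ℝ u x := by
    intro x hx
    rcases eq_or_ne x 0 with rfl | h
    · simp
    · exact (hupos x hx h).le
  by_cases hdeg : ∃ r ∈ l, r.1 ≠ 0 ∧ ∀ x ∈ C₁, inner ℝ r.1 x = 0
  · obtain ⟨r, -, hr0, hr⟩ := hdeg
    exact hm.simple C₁ r.1 0 hb hr0 hr
  push Not at hdeg
  obtain ⟨R, hR0, hR⟩ : ∃ R > 0, ∀ x ∈ C₁, ‖x‖ ≤ R := by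
    obtain ⟨R, hR⟩ := hb.2.1.isBounded.exists_norm_le
    exact ⟨max R 1, by positivity, fun x hx => (hR x hx).trans (le_max_left _ _)⟩
  have hq : ∀ l' : List (E × ℝ), (∀ r ∈ l', r ∈ l) → ∃ q ∈ C, ∀ r ∈ l', ∀ x ∈ C₁, inner ℝ r.1 q ≤ inner ℝ r.1 x := by
    intro l'
    induction l' with
    | nil => intro _; exact ⟨0, hC0, by simp⟩
    | cons r l' ih =>
      intro hsub
      obtain ⟨q, hqC, hq⟩ := ih (fun r' hr' => hsub r' (List.mem_cons_of_mem _ hr'))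
      by_cases hr0 : r.1 = 0
      · refine ⟨q, hqC, fun r' hr' x hx => ?_⟩
        rcases List.mem_cons.1 hr' with rfl | h
        · simp [hr0]
        · exact hq r' h x hx
      have hrl := hsub r List.mem_cons_self
      obtain ⟨y, hy, hyr⟩ := hdeg r hrl hr0
      have hyneg : inner ℝ r.1 y < 0 := lt_of_le_of_ne ((hCm y).1 hy.2 r hrl) hyr
      have hs : 0 ≤ ‖r.1‖ * R / (-inner ℝ r.1 y) := div_nonneg (by positivity) (by linarith)
      refine ⟨q + (‖r.1‖ * R / (-inner ℝ r.1 y)) • y, hCadd _ hqC _ (hCsm _ hs _ hy.2), fun r' hr' x hx => ?_⟩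
      rw [inner_add_right, inner_smul_right]
      rcases List.mem_cons.1 hr' with rfl | h
      · have h1 : ‖r'.1‖ * R / (-inner ℝ r'.1 y) * inner ℝ r'.1 y = - (‖r'.1‖ * R) := by
          rw [div_neg, neg_mul, div_mul_cancel₀ _ hyneg.ne]
        have h2 := (hCm q).1 hqC r' hrl
        have h3 : |inner ℝ r'.1 x| ≤ ‖r'.1‖ * R :=
          (abs_real_inner_le_norm _ _).trans (by gcongr; exact hR x hx)
        linarith [(abs_le.1 h3).1]
      · have h1 := hq r' h x hx
        have h2 := (hCm y).1 hy.2 r' (hsub r' hr')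
        nlinarith [mul_nonpos_of_nonneg_of_nonpos hs h2]
  obtain ⟨q₀, hq₀C, hq₀⟩ := hq l (fun r hr => hr)
  rcases eq_or_ne q₀ 0 with rfl | hq₀0
  · refine hm.simple C₁ v 0 hb hv fun x hx => ?_
    rcases eq_or_ne x 0 with rfl | hx0
    · simp
    exfalso
    have h1 : -x ∈ C := by
      rw [hCm]; intro r hr
      have := hq₀ r hr x hx
      rw [inner_zero_right] at this
      rw [inner_neg_right]; linarith
    have h2 := hupos x hx.2 hx0
    have h3 := hupos (-x) h1 (neg_ne_zero.2 hx0)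
    rw [inner_neg_right] at h3
    linarith
  have huq₀ := hupos q₀ hq₀C hq₀0
  obtain ⟨q, hqC, hq, huq⟩ : ∃ q ∈ C, (∀ x ∈ C₁, q - x ∈ C) ∧ 2 ≤ inner ℝ u q := by
    have hs : 0 ≤ 2 / inner ℝ u q₀ := by positivity
    refine ⟨q₀ + (2 / inner ℝ u q₀) • q₀, hCadd _ hq₀C _ (hCsm _ hs _ hq₀C), fun x hx => ?_, ?_⟩
    · rw [hCm]
      intro r hr
      rw [inner_sub_right, inner_add_right, inner_smul_right]
      have h1 := hq₀ r hr x hx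
      have h2 := mul_nonpos_of_nonneg_of_nonpos hs ((hCm q₀).1 hq₀C r hr)
      linarith
    · rw [inner_add_right, inner_smul_right, div_mul_cancel₀ _ huq₀.ne']
      linarith
  have hu : u ≠ 0 := by
    rintro rfl
    rw [inner_zero_left] at huq; linarith
  set B : Set E := C ∩ {x | q - x ∈ C} with hB
  have hsymB : ∀ x ∈ B, q - x ∈ B := fun x hx => ⟨hx.2, by
    show q - (q - x) ∈ C
    rw [sub_sub_cancel]; exact hx.1⟩
  have hBconv : Convex ℝ B := by
    refine (convex_poly l).inter ?_
    intro x hx y hy a b ha hb hab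
    have : q - (a • x + b • y) = a • (q - x) + b • (q - y) := by
      rw [smul_sub, smul_sub, sub_add_sub_comm, ← add_smul, hab, one_smul]
    show q - (a • x + b • y) ∈ C
    rw [this]
    exact convex_poly l hx hy ha hb hab
  have hBcl : IsClosed B := (isClosed_poly l).inter ((isClosed_poly l).preimage (by fun_prop))
  have hBsub : B ⊆ (inner ℝ u q) • C₁ := by
    intro x hx
    have h1 := hunn _ hx.2
    rw [inner_sub_right] at h1
    have hpos : 0 < inner ℝ u q := by linarith
    refine ⟨(inner ℝ u q)⁻¹ • x, ⟨?_, hCsm _ (by positivity) _ hx.1⟩, ?_⟩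
    · show inner ℝ u ((inner ℝ u q)⁻¹ • x) ≤ 1
      rw [inner_smul_right, inv_mul_le_iff₀ hpos]; linarith
    · simp only [smul_smul, mul_inv_cancel₀ hpos.ne', one_smul]
  have hBcomp : IsCompact B := (hb.smul _).2.1.of_isClosed_subset hBcl hBsub
  have hBb : IsBody B := ⟨hBconv, hBcomp, ⟨0, hC0, by simpa using hqC⟩⟩
  have e1 : B ∩ {x | inner ℝ u x ≤ 1} = C₁ := by
    ext x
    exact ⟨fun hx => ⟨hx.2, hx.1.1⟩, fun hx => ⟨⟨hx.2, hq x hx⟩, hx.1⟩⟩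
  have hgb : IsBody ({q} + -C₁) := (isBody_singleton q).add hb.neg
  have e2 : B ∩ {x | 1 ≤ inner ℝ u x} ∩ {x | inner ℝ u q - 1 ≤ inner ℝ u x} = {q} + -C₁ := by
    ext x
    rw [mem_singleton_add]
    constructor
    · rintro ⟨⟨hx, -⟩, hx2⟩
      have hx2' : inner ℝ u q - 1 ≤ inner ℝ u x := hx2
      refine ⟨x - q, ?_, by abel⟩
      rw [Set.mem_neg, neg_sub, ← e1]
      refine ⟨hsymB x hx, ?_⟩
      show inner ℝ u (q - x) ≤ 1
      rw [inner_sub_right]; linarith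
    · rintro ⟨k, hk, rfl⟩
      rw [Set.mem_neg] at hk
      have h1 : -k ∈ B := by rw [← e1] at hk; exact hk.1
      have h2 := hsymB _ h1
      rw [sub_neg_eq_add] at h2
      have h3 : inner ℝ u (-k) ≤ 1 := hk.1
      rw [inner_neg_right] at h3
      refine ⟨⟨h2, ?_⟩, ?_⟩
      · show 1 ≤ inner ℝ u (q + k)
        rw [inner_add_right]; linarith
      · show inner ℝ u q - 1 ≤ inner ℝ u (q + k)
        rw [inner_add_right]; linarith
  have hB1 : Convex ℝ (B ∩ {x | 1 ≤ inner ℝ u x}) := hBconv.inter (convex_ge_inner _ _)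
  have hB1c : IsCompact (B ∩ {x | 1 ≤ inner ℝ u x}) := hBcomp.inter_right (isClosed_ge_inner _ _)
  have hM : m (B ∩ {x | 1 ≤ inner ℝ u x} ∩ {x | inner ℝ u x ≤ inner ℝ u q - 1}) = 0 := by
    rcases (B ∩ {x | 1 ≤ inner ℝ u x} ∩ {x | inner ℝ u x ≤ inner ℝ u q - 1}).eq_empty_or_nonempty with he | he
    · rw [he, hm.empty]
    refine hm.symm_zero' hg hv (q := q) ⟨hB1.inter (convex_le_inner _ _), hB1c.inter_right (isClosed_le_inner _ _), he⟩ ?_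
    rintro x ⟨⟨hx, hx1⟩, hx2⟩
    have hx1' : 1 ≤ inner ℝ u x := hx1
    have hx2' : inner ℝ u x ≤ inner ℝ u q - 1 := hx2
    refine ⟨⟨hsymB x hx, ?_⟩, ?_⟩
    · show 1 ≤ inner ℝ u (q - x)
      rw [inner_sub_right]; linarith
    · show inner ℝ u (q - x) ≤ inner ℝ u q - 1
      rw [inner_sub_right]; linarith
  have c1 := hm.cut hBconv hBcomp hu 1
  have c2 := hm.cut hB1 hB1c hu (inner ℝ u q - 1)
  rw [hm.symm_zero' hg hv hBb hsymB, e1, c2, hM, e2, hm.trans _ _ hb.neg, hp _ hb] at c1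
  have : (2 : ℂ) * m C₁ = 0 := by linear_combination -c1
  simpa using this

end Klain


section Induction

universe uE

section General
variable {E : Type uE} [NormedAddCommGroup E] [InnerProductSpace ℝ E] [FiniteDimensional ℝ E]

theorem finrank_Hp {n : ℕ} (h : Module.finrank ℝ E = n + 1) {v : E} (hv : v ≠ 0) :
    Module.finrank ℝ (Hp v) = n := by
  have : Fact (Module.finrank ℝ E = n + 1) := ⟨h⟩
  exact Submodule.finrank_orthogonal_span_singleton hv

theorem exists_ne_zero_of_finrank {n : ℕ} (h : Module.finrank ℝ E = n + 1) : ∃ v : E, v ≠ 0 :=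
  (Module.finrank_pos_iff_exists_ne_zero (R := ℝ)).1 (by omega)

theorem exists_perp {n : ℕ} (h : Module.finrank ℝ E = n + 2) (a : E) : ∃ w : E, w ≠ 0 ∧ inner ℝ a w = 0 := by
  rcases eq_or_ne a 0 with rfl | ha
  · obtain ⟨w, hw⟩ := exists_ne_zero_of_finrank h
    exact ⟨w, hw, by simp⟩
  · obtain ⟨w, hw⟩ := exists_ne_zero_of_finrank (finrank_Hp h ha)
    exact ⟨w, by simpa using hw, inner_Hp w⟩

theorem isBody_coe {v : E} {F : Set (Hp v)} (hF : IsBody F) : IsBody ((fun y : Hp v => (y : E)) '' F) := by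
  refine ⟨?_, hF.2.1.image (by fun_prop), hF.2.2.image _⟩
  have := hF.1.linear_image (Hp v).subtype
  exact this

theorem aff_zero {a : E} (ha : a = 0) (c : ℝ) (y : E) : aff a c y = c := by
  rw [ha]; simp [aff]

theorem dim1_reg (h : Module.finrank ℝ E = 1) {v : E} (hv : v ≠ 0) (a : Hp v) : a = 0 := by
  have h0 : Module.finrank ℝ (Hp v) = 0 := finrank_Hp h hv
  have := Module.finrank_zero_iff.1 h0
  exact Subsingleton.elim _ _

theorem Good.dim1 {m : Set E → ℂ} (h : Module.finrank ℝ E = 1) {v : E} (hv : v ≠ 0) (hm : SV m)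
    (hg : Good m v) {K : Set E} (hK : IsBody K) : m K = 0 := by
  refine hm.eq_zero_of_reg hv (fun F a c hF hc => ?_) hK
  obtain rfl := dim1_reg h hv a
  obtain ⟨y, hy⟩ := hF.2.2
  have h0 := hc y hy
  rw [aff_zero rfl] at h0
  have := hg.reg hm hv hF 0 0 h0
  rwa [zero_add] at this

theorem SV.hom1 {m : Set E → ℂ} (h : Module.finrank ℝ E = 1) (hm : SV m) {t : ℝ} (ht : 0 < t)
    {K : Set E} (hK : IsBody K) : m (t • K) = t * m K := by
  obtain ⟨v, hv⟩ := exists_ne_zero_of_finrank h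
  have hs := (hm.dil ht).lin hm 1 (-t)
  have := hs.eq_zero_of_reg hv (fun F a c hF hc => ?_) hK
  · linear_combination this
  obtain rfl := dim1_reg h hv a
  obtain ⟨y, hy⟩ := hF.2.2
  have h0 := hc y hy
  rw [aff_zero rfl] at h0
  have hFt : t • F = F := by
    ext z
    have hz : z = y := (dim1_reg h hv z).trans (dim1_reg h hv y).symm
    subst hz
    refine ⟨fun _ => hy, fun _ => ⟨z, hy, ?_⟩⟩
    exact (dim1_reg h hv _).trans (dim1_reg h hv _).symm
  rw [smul_Reg hv ht, hFt, hm.prism_lin hv hF h0, hm.prism_lin hv hF (by positivity : 0 ≤ t * c)]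
  push_cast
  ring

/-- transfer of goodness to hyperplanes -/
theorem Good.transfer {m : Set E → ℂ} {v v' : E} (hm : SV m) (hv : v ≠ 0) (hv' : v' ≠ 0)
    (hw : pr v' v ≠ 0) (hg : Good m v) : Good (T0 m v') (pr v' v) := by
  intro F hF
  obtain ⟨w, lam, hvd⟩ := decomp v' v
  have hprw : pr v' v = w := by rw [hvd, pr_add]
  rw [hprw] at hw
  revert F
  rw [hprw]
  intro F hF
  set B : Set (Hp v') := Reg w F (aff 0 0) (aff 0 1) with hB
  have bB : IsBody B := isBody_Reg hF (fun y _ => by simp [aff])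
  have hww : inner ℝ w w ≠ 0 := inner_self_ne_zero.2 hw
  set a : Hp v' := (lam / inner ℝ w w) • w with ha
  have haz : ∀ (z : Hp w) (s : ℝ), inner ℝ a ((z : Hp v') + s • w) = lam * s := by
    intro z s
    rw [ha, real_inner_smul_left, inner_add_right, inner_smul_right, inner_Hp]
    field_simp
    ring
  rw [T0, ← hm.reg_prism hv' bB a 0 zero_le_one, zero_add]
  have hb' : IsBody (Reg v' ((fun y : Hp w => (y : Hp v')) '' F) (aff 0 0) (aff 0 1)) :=
    isBody_Reg (isBody_coe hF) (fun y _ => by simp [aff])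
  have heq : Reg v' B (aff a 0) (aff a 1) =
      Reg v' ((fun y : Hp w => (y : Hp v')) '' F) (aff 0 0) (aff 0 1) + sg v := by
    ext x
    constructor
    · rintro ⟨y, ⟨z, hz, s, hs0, hs1, rfl⟩, τ, h1, h2, rfl⟩
      rw [aff_zero rfl] at hs0 hs1
      rw [aff, haz] at h1 h2
      refine ⟨((z : Hp v') : E) + (τ - lam * s) • v', ⟨z, ⟨z, hz, rfl⟩, τ - lam * s, ?_, ?_, rfl⟩,
        s • v, mem_sg.2 ⟨s, hs0, hs1, rfl⟩, ?_⟩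
      · rw [aff_zero rfl]; linarith
      · rw [aff_zero rfl]; linarith
      · simp only
        rw [hvd, Submodule.coe_add, Submodule.coe_smul]
        module
    · rintro ⟨_, ⟨_, ⟨z, hz, rfl⟩, σ, h1, h2, rfl⟩, _, hy, rfl⟩
      obtain ⟨s, hs0, hs1, rfl⟩ := mem_sg.1 hy
      rw [aff_zero rfl] at h1 h2
      refine ⟨(z : Hp v') + s • w, ⟨z, hz, s, ?_, ?_, rfl⟩, lam * s + σ, ?_, ?_, ?_⟩
      · rwa [aff_zero rfl]
      · rwa [aff_zero rfl]
      · rw [aff, haz]; linarith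
      · rw [aff, haz]; linarith
      · simp only
        rw [hvd, Submodule.coe_add, Submodule.coe_smul]
        module
  rw [heq]
  refine hg.oblique hm hv hb' (u := (w : E)) (by simpa using hw) (c := 0) ?_
  rintro _ ⟨_, ⟨z, hz, rfl⟩, σ, h1, h2, rfl⟩
  rw [inner_add_right, inner_smul_right, inner_Hp', mul_zero, add_zero]
  exact inner_Hp z

theorem Good.Ta_good {m : Set E → ℂ} {v : E} (hm : SV m) (hv : v ≠ 0) (hg : Good m v) {a w : Hp v}
    (hw : w ≠ 0) (haw : inner ℝ a w = 0) (hgw : Good m (w : E)) : Good (Ta m v a) w := by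
  intro F hF
  have hw' : (w : E) ≠ 0 := by simpa using hw
  set B : Set (Hp v) := Reg w F (aff 0 0) (aff 0 1) with hB
  have bB : IsBody B := isBody_Reg hF (fun y _ => by simp [aff])
  obtain ⟨C, hC⟩ := exists_shift bB.2.1 a
  have haz : ∀ (z : Hp w) (s : ℝ), aff a C ((z : Hp v) + s • w) = aff a C z := by
    intro z s
    rw [aff, aff, inner_add_right, inner_smul_right, haw, mul_zero, add_zero]
  have hC' : ∀ z ∈ F, 0 ≤ aff a C (z : Hp v) := by
    intro z hz
    rw [← haz z 0]
    refine hC _ ⟨z, hz, 0, ?_, ?_, rfl⟩ <;> simp [aff]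
  rw [hg.Ta_eq hm hv bB hC]
  have hb' : IsBody (Reg v ((fun y : Hp w => (y : Hp v)) '' F) (aff 0 0) (aff a C)) := by
    refine isBody_Reg (isBody_coe hF) ?_
    rintro _ ⟨z, hz, rfl⟩
    rw [aff_zero rfl]; exact hC' z hz
  have heq : Reg v B (aff 0 0) (aff a C) =
      Reg v ((fun y : Hp w => (y : Hp v)) '' F) (aff 0 0) (aff a C) + sg (w : E) := by
    ext x
    constructor
    · rintro ⟨y, ⟨z, hz, s, hs0, hs1, rfl⟩, τ, h1, h2, rfl⟩
      rw [aff_zero rfl] at hs0 hs1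
      rw [haz] at h2
      refine ⟨((z : Hp v) : E) + τ • v, ⟨z, ⟨z, hz, rfl⟩, τ, ?_, h2, rfl⟩,
        s • (w : E), mem_sg.2 ⟨s, hs0, hs1, rfl⟩, ?_⟩
      · rwa [aff_zero rfl] at h1 ⊢
      · simp only
        rw [Submodule.coe_add, Submodule.coe_smul]
        module
    · rintro ⟨_, ⟨_, ⟨z, hz, rfl⟩, σ, h1, h2, rfl⟩, _, hy, rfl⟩
      obtain ⟨s, hs0, hs1, rfl⟩ := mem_sg.1 hy
      refine ⟨(z : Hp v) + s • w, ⟨z, hz, s, ?_, ?_, rfl⟩, σ, ?_, ?_, ?_⟩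
      · rwa [aff_zero rfl]
      · rwa [aff_zero rfl]
      · rwa [aff_zero rfl] at h1 ⊢
      · rwa [haz]
      · simp only
        rw [Submodule.coe_add, Submodule.coe_smul]
        module
  rw [heq]
  refine hgw.oblique hm hw' hb' (u := (w : E)) hw' (c := 0) ?_
  rintro _ ⟨_, ⟨z, hz, rfl⟩, σ, h1, h2, rfl⟩
  rw [inner_add_right, inner_smul_right, inner_Hp', mul_zero, add_zero]
  exact inner_Hp z

end General

theorem even_zero (n : ℕ) : ∀ (E : Type uE) [NormedAddCommGroup E] [InnerProductSpace ℝ E]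
    [FiniteDimensional ℝ E], Module.finrank ℝ E = n + 1 → ∀ m : Set E → ℂ, SV m → Par 1 m →
    ∀ v : E, v ≠ 0 → Good m v → ∀ K, IsBody K → m K = 0 := by
  induction n with
  | zero =>
    intro E _ _ _ h m hm _ v hv hg K hK
    exact hg.dim1 h hv hm hK
  | succ n ih =>
    intro E _ _ _ h m hm hp v hv hg K hK
    have claim : ∀ v v' : E, v ≠ 0 → v' ≠ 0 → pr v' v ≠ 0 → Good m v → Good m v' := by
      intro v v' hv hv' hw hg F hF
      exact ih (Hp v') (finrank_Hp h hv') (T0 m v') (hm.T0 hv') (hp.T0 hm hv') _ hw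
        (hg.transfer hm hv hv' hw) F hF
    refine hm.klain hp (fun v' hv' => ?_) hv hK
    by_cases hw : pr v' v = 0
    · obtain ⟨z, hz⟩ := exists_ne_zero_of_finrank (finrank_Hp h hv')
      have hz' : (z : E) ≠ 0 := by simpa using hz
      obtain ⟨y, s, hd⟩ := decomp v' v
      have hy : y = 0 := by rw [← hw, hd, pr_add]
      rw [hy, Submodule.coe_zero, zero_add] at hd
      have hzv : inner ℝ (z : E) v = 0 := by rw [hd, inner_smul_right, inner_Hp', mul_zero]
      have h1 : pr (z : E) v ≠ 0 := by
        have := pr_add (⟨v, Submodule.mem_orthogonal_singleton_iff_inner_right.2 hzv⟩ : Hp (z : E)) 0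
        simp only [zero_smul, add_zero] at this
        rw [this]
        simpa using hv
      have h2 : pr v' (z : E) ≠ 0 := by
        have := pr_add z 0
        simp only [zero_smul, add_zero] at this
        rw [this]
        exact hz
      exact claim z v' hz' hv' h2 (claim v z hv hz' h1 hg)
    · exact claim v v' hv hv' hw hg

theorem odd_hom (n : ℕ) : ∀ (E : Type uE) [NormedAddCommGroup E] [InnerProductSpace ℝ E]
    [FiniteDimensional ℝ E], Module.finrank ℝ E = n → ∀ m : Set E → ℂ, SV m → Par (-1) m →
    ∀ t : ℝ, 0 < t → ∀ K, IsBody K → (t : ℂ) * m (t • K) = t ^ n * m K := by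
  have dim0 : ∀ (E : Type uE) [NormedAddCommGroup E] [InnerProductSpace ℝ E]
    [FiniteDimensional ℝ E], Module.finrank ℝ E = 0 → ∀ m : Set E → ℂ, Par (-1) m →
      ∀ K, IsBody K → m K = 0 := by
    intro E _ _ _ h m hp K hK
    have := Module.finrank_zero_iff.1 h
    have hn : -K = K := by
      ext x
      rw [Set.mem_neg, Subsingleton.elim (-x) x]
    have := hp K hK
    rw [hn] at this
    have h2 : (2 : ℂ) * m K = 0 := by linear_combination this
    simpa using h2
  have dim1 : ∀ (E : Type uE) [NormedAddCommGroup E] [InnerProductSpace ℝ E]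
    [FiniteDimensional ℝ E], Module.finrank ℝ E = 1 → ∀ m : Set E → ℂ, SV m → Par (-1) m →
      ∀ K, IsBody K → m K = 0 := by
    intro E _ _ _ h m hm hp K hK
    obtain ⟨v, hv⟩ := exists_ne_zero_of_finrank h
    refine Good.dim1 h hv hm (fun F hF => ?_) hK
    exact dim0 (Hp v) (finrank_Hp h hv) (T0 m v) (hp.T0 hm hv) F hF
  induction n with
  | zero =>
    intro E _ _ _ h m hm hp t ht K hK
    rw [dim0 E h m hp _ hK, dim0 E h m hp _ (hK.smul t), mul_zero, mul_zero]
  | succ n ih =>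
    intro E _ _ _ h m hm hp t ht K hK
    rcases n with _ | _ | n
    · rw [dim1 E h m hm hp _ hK, dim1 E h m hm hp _ (hK.smul t), mul_zero, mul_zero]
    · obtain ⟨v, hv⟩ := exists_ne_zero_of_finrank h
      have hg : Good m v := fun F hF =>
        dim1 (Hp v) (finrank_Hp h hv) (T0 m v) (hm.T0 hv) (hp.T0 hm hv) F hF
      have hs := (hm.dil ht).lin hm 1 (-t)
      have := hs.eq_zero_of_reg hv (fun F a c hF hc => ?_) hK
      · linear_combination (t : ℂ) * this
      have hc' : ∀ y ∈ t • F, 0 ≤ aff a (t * c) y := by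
        rintro _ ⟨y, hy, rfl⟩
        have := mul_nonneg ht.le (hc y hy)
        simp only [aff, inner_smul_right] at this ⊢
        linarith
      rw [smul_Reg hv ht, ← hg.Ta_eq hm hv hF hc, ← hg.Ta_eq hm hv (hF.smul t) hc',
        (hg.Ta_SV hm hv a).hom1 (finrank_Hp h hv) ht hF]
      ring
    · set ψ : Set E → ℂ := fun K => (t : ℂ) * m (t • K) + (-(t : ℂ) ^ (n + 3)) * m K with hψ
      have hψs : SV ψ := (hm.dil ht).lin hm t (-(t : ℂ) ^ (n + 3))
      have hψp : Par (-1) ψ := by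
        intro K hK
        simp only [hψ]
        have hneg : t • -K = -(t • K) := by
          ext x
          rw [Set.mem_neg, mem_smul_set_iff_inv_smul_mem₀ ht.ne', mem_smul_set_iff_inv_smul_mem₀ ht.ne',
            Set.mem_neg, smul_neg]
        rw [hp K hK, hneg, hp _ (hK.smul t)]
        ring
      have hψg : ∀ v, v ≠ 0 → Good ψ v := by
        intro v hv F hF
        have h1 := ih (Hp v) (finrank_Hp h hv) (T0 m v) (hm.T0 hv) (hp.T0 hm hv) t ht F hF
        simp only [hψ]
        rw [smul_Reg hv ht, mul_one, hm.prism_lin hv (hF.smul t) ht.le]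
        rw [T0, T0] at h1
        linear_combination (t : ℂ) * h1
      suffices hz : ψ K = 0 by
        simp only [hψ] at hz
        linear_combination hz
      obtain ⟨v, hv⟩ := exists_ne_zero_of_finrank h
      refine hψs.eq_zero_of_reg hv (fun F a c hF hc => ?_) hK
      rw [← (hψg v hv).Ta_eq hψs hv hF hc]
      have hd : Module.finrank ℝ (Hp v) = n + 2 := finrank_Hp h hv
      obtain ⟨w, hw, haw⟩ := exists_perp hd a
      exact even_zero (n + 1) (Hp v) hd (Ta ψ v a) ((hψg v hv).Ta_SV hψs hv a)
        ((hψg v hv).Ta_Par hψs hv a hψp) w hw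
        ((hψg v hv).Ta_good hψs hv hw haw (hψg w (by simpa using hw))) F hF

end Induction


/-- (a consequence of Schneider's theorem) a continuous, translation invariant,
odd, simple valuation is homogeneous of degree `n - 1`. -/
theorem statement12 {V : Type*} [NormedAddCommGroup V] [InnerProductSpace ℝ V]
    [FiniteDimensional ℝ V]
    (n : ℕ) (hV : Module.finrank ℝ V = n)
    (μ : ConvexBody V → ℂ) (hval : IsValuationC μ) (hcont : Continuous μ)
    (htrans : IsTranslationInvariantC μ) (hodd : IsOddValC μ)
    (hsimple : IsSimpleValC n μ) :
    IsHomogeneousValC (n - 1) μ := by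
  classical
  have hmk : ∀ K : ConvexBody V, IsBody (K : Set V) := fun K => ⟨K.convex, K.isCompact, K.nonempty⟩
  set m : Set V → ℂ := fun S => if h : IsBody S then μ ⟨S, h.1, h.2.1, h.2.2⟩ else 0 with hmdef
  have hm1 : ∀ K : ConvexBody V, m (K : Set V) = μ K := by
    intro K
    simp only [hmdef]
    rw [dif_pos (hmk K)]
    rfl
  have hm2 : ∀ S, IsBody S → ∃ K : ConvexBody V, (K : Set V) = S := fun S h => ⟨⟨S, h.1, h.2.1, h.2.2⟩, rfl⟩
  have hodd' : Par (-1) m := by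
    intro S hS
    obtain ⟨K, rfl⟩ := hm2 S hS
    obtain ⟨L, hL⟩ := hm2 _ hS.neg
    rw [← hL, hm1, hm1, hodd K L hL]
    ring
  rcases n with _ | n
  · have := Module.finrank_zero_iff.1 hV
    have h0 : ∀ K, μ K = 0 := by
      intro K
      have := hodd K K (by ext x; rw [Set.mem_neg, Subsingleton.elim (-x) x])
      have h2 : (2 : ℂ) * μ K = 0 := by linear_combination this
      simpa using h2
    intro t ht K L _
    rw [h0, h0, mul_zero]
  have hm : SV m := by
    refine ⟨?_, ?_, ?_, ?_, ?_⟩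
    · simp only [hmdef]
      rw [dif_neg (fun h => Set.not_nonempty_empty h.2.2)]
    · intro K L hK hL hU hI
      obtain ⟨K, rfl⟩ := hm2 _ hK
      obtain ⟨L, rfl⟩ := hm2 _ hL
      obtain ⟨M, hM⟩ := hm2 _ hU
      obtain ⟨N, hN⟩ := hm2 _ hI
      rw [← hM, ← hN, hm1, hm1, hm1, hm1]
      exact hval K L M N hM hN
    · intro K hK ε hε
      obtain ⟨K, rfl⟩ := hm2 _ hK
      obtain ⟨δ, hδ, h⟩ := Metric.continuous_iff.1 hcont K ε hε
      refine ⟨δ / 2, by positivity, fun L hL hc => ?_⟩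
      obtain ⟨L, rfl⟩ := hm2 _ hL
      rw [hm1, hm1, ← dist_eq_norm]
      refine h L ?_
      have : dist L K ≤ δ / 2 := by
        show hausdorffDist (L : Set V) (K : Set V) ≤ δ / 2
        refine hausdorffDist_le_of_mem_dist (by positivity) (fun x hx => ?_) (fun x hx => ?_)
        · obtain ⟨y, hy, hd⟩ := hc.2 x hx
          exact ⟨y, hy, by rwa [dist_comm]⟩
        · obtain ⟨y, hy, hd⟩ := hc.1 x hx
          exact ⟨y, hy, hd⟩
      linarith
    · intro x K hK
      obtain ⟨L, hL⟩ := hm2 _ ((isBody_singleton x).add hK)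
      obtain ⟨K, rfl⟩ := hm2 _ hK
      rw [← hL, hm1, hm1]
      refine htrans x K L ?_
      rw [hL]
      ext y
      rw [mem_singleton_add]
      rfl
    · intro K u c hK hu h
      obtain ⟨K, rfl⟩ := hm2 _ hK
      rw [hm1]
      obtain ⟨x, hx⟩ := hK.2.2
      refine hsimple K ⟨Hp u, x, finrank_Hp hV hu, fun y hy => ?_⟩
      refine ⟨y - x, ?_, by simp⟩
      refine Submodule.mem_orthogonal_singleton_iff_inner_right.2 ?_
      rw [inner_sub_right, h y hy, h x hx, sub_self]
  have hpos : ∀ t : ℝ, 0 < t → ∀ K, IsBody K → m (t • K) = (t : ℂ) ^ n * m K := by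
    intro t ht K hK
    have h1 := odd_hom (n + 1) V hV m hm hodd' t ht K hK
    have ht' : (t : ℂ) ≠ 0 := by exact_mod_cast ht.ne'
    refine mul_left_cancel₀ ht' ?_
    rw [h1]; ring
  intro t ht K L hL
  rw [Nat.add_sub_cancel, ← hm1, ← hm1, hL]
  rcases ht.eq_or_lt with rfl | ht
  · have hz : (0 : ℝ) • (K : Set V) = {0} := by
      rw [Set.zero_smul_set K.nonempty]; rfl
    rw [hz]
    have hl1 : Filter.Tendsto (fun t : ℝ => m (t • (K : Set V))) (nhdsWithin 0 (Ioi 0)) (nhds (m {0})) := by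
      rw [Metric.tendsto_nhds]
      intro ε hε
      obtain ⟨δ, hδ, h⟩ := hm.cont {0} (isBody_singleton 0) ε hε
      obtain ⟨R, hR0, hR⟩ : ∃ R > 0, ∀ x ∈ (K : Set V), ‖x‖ ≤ R := by
        obtain ⟨R, hR⟩ := K.isCompact.isBounded.exists_norm_le
        exact ⟨max R 1, by positivity, fun x hx => (hR x hx).trans (le_max_left _ _)⟩
      have hmem : Ioo (0 : ℝ) (δ / R) ∈ nhdsWithin (0 : ℝ) (Ioi 0) :=
        Ioo_mem_nhdsGT (by positivity)
      filter_upwards [hmem] with t ht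
      rw [dist_eq_norm]
      have hb : ∀ x ∈ (K : Set V), dist 0 (t • x) ≤ δ := by
        intro x hx
        rw [dist_zero_left, norm_smul, Real.norm_of_nonneg ht.1.le]
        calc t * ‖x‖ ≤ δ / R * R := mul_le_mul ht.2.le (hR x hx) (norm_nonneg _) (by positivity)
          _ = δ := by field_simp
      refine h _ ((hmk K).smul t) ⟨?_, ?_⟩
      · intro x hx
        obtain ⟨k, hk⟩ := K.nonempty
        rw [mem_singleton_iff.1 hx]
        exact ⟨t • k, smul_mem_smul_set hk, hb k hk⟩
      · rintro _ ⟨k, hk, rfl⟩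
        exact ⟨0, rfl, hb k hk⟩
    have hl2 : Filter.Tendsto (fun t : ℝ => (t : ℂ) ^ n * m (K : Set V)) (nhdsWithin 0 (Ioi 0))
        (nhds (((0 : ℝ) : ℂ) ^ n * m (K : Set V))) := by
      have : Continuous (fun t : ℝ => (t : ℂ) ^ n * m (K : Set V)) := by fun_prop
      exact this.continuousAt.tendsto.mono_left nhdsWithin_le_nhds
    refine tendsto_nhds_unique hl1 (hl2.congr' ?_)
    filter_upwards [self_mem_nhdsWithin] with t ht
    exact (hpos t ht _ (hmk K)).symm
  · exact hpos t ht _ (hmk K)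

end
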